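/- (Shoenfield's completeness theorem, Tait version.) For every sentence A of arithmetic that is true in ℕ there exists a recursive local code a ∈ C_rec^- such that End(a) = {A} and π(a) is a primitive recursive cut-free ω-proof (i.e. π(a) : ℕ → ℕ is a primitive recursive function, is an ω-proof with no node labelled cut, and its end sequent is {A}). -/

import Mathlib

namespace Shoen

/-- Kleene application: value of the `e`-th partial recursive function at `n`,
in the standard numbering via `Nat.Partrec.Code`. -/
def peval (e n : ℕ) : Part ℕ := (Denumerable.ofNat Nat.Partrec.Code e).eval n

/-- `e` is an index of a (total) primitive recursive function. -/
def PrimIndex (e : ℕ) : Prop := ∃ f : ℕ → ℕ, Nat.Primrec f ∧ ∀ n, peval e n = Part.some (f n)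

/-- Kleene's relation `<_O`. -/
inductive KLt : ℕ → ℕ → Prop
  | base : KLt 1 2
  | step {a b : ℕ} : KLt a b → KLt b (2 ^ b)
  | lim {e : ℕ} (h : ∀ n, (peval e n).Dom)
      (hm : ∀ n, KLt ((peval e n).get (h n)) ((peval e (n + 1)).get (h (n + 1))))
      (n : ℕ) : KLt ((peval e n).get (h n)) (3 * 5 ^ e)
  | trans {a b c : ℕ} : KLt a b → KLt b c → KLt a c

/-- Kleene's `O`. -/
def KO (a : ℕ) : Prop := KLt a (2 ^ a)

/-- The auxiliary relation `<'_O`. -/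
inductive KLt' : ℕ → ℕ → Prop
  | base : KLt' 1 2
  | step {a b : ℕ} : KLt' a b → KLt' b (2 ^ b)
  | lim {e n x : ℕ} : x ∈ peval e n → KLt' x (3 * 5 ^ e)
  | trans {a b c : ℕ} : KLt' a b → KLt' b c → KLt' a c

/-- The inductive characterization `O'` of Kleene's `O`. -/
inductive KO' : ℕ → Prop
  | one : KO' 1
  | step {a : ℕ} : KO' a → KO' (2 ^ a)
  | lim {e : ℕ} (h : ∀ n, (peval e n).Dom)
      (hm : ∀ n, KLt' ((peval e n).get (h n)) ((peval e (n + 1)).get (h (n + 1)))) :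
      KO' (3 * 5 ^ e)



/-! ### Syntax of first order arithmetic (negation normal form) -/

/-- Terms of the language `0,1,+,×,=`, with de Bruijn variables. -/
inductive Trm : Type
  | var : ℕ → Trm
  | zero : Trm
  | one : Trm
  | add : Trm → Trm → Trm
  | mul : Trm → Trm → Trm
deriving DecidableEq

/-- Formulas in negation normal form: literals (atomic and negated atomic
formulas) combined by `∧, ∨, ∀, ∃` (de Bruijn binders). -/
inductive Fml : Type
  | eq : Trm → Trm → Fml
  | ne : Trm → Trm → Fml
  | and : Fml → Fml → Fml
  | or : Fml → Fml → Fml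
  | all : Fml → Fml
  | ex : Fml → Fml
deriving DecidableEq

/-- All free variables of a term are `< k`. -/
def Trm.cu : Trm → ℕ → Bool
  | .var i, k => decide (i < k)
  | .zero, _ => true
  | .one, _ => true
  | .add s t, k => s.cu k && t.cu k
  | .mul s t, k => s.cu k && t.cu k

/-- All free variables of a formula are `< k`. -/
def Fml.cu : Fml → ℕ → Bool
  | .eq s t, k => s.cu k && t.cu k
  | .ne s t, k => s.cu k && t.cu k
  | .and A B, k => A.cu k && B.cu k
  | .or A B, k => A.cu k && B.cu k
  | .all A, k => A.cu (k + 1)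
  | .ex A, k => A.cu (k + 1)

/-- A sentence is a closed formula. -/
abbrev Sentence : Type := { A : Fml // A.cu 0 = true }

/-- Value of a term under an environment. -/
def Trm.val (ρ : ℕ → ℕ) : Trm → ℕ
  | .var i => ρ i
  | .zero => 0
  | .one => 1
  | .add s t => s.val ρ + t.val ρ
  | .mul s t => s.val ρ * t.val ρ

/-- Extend an environment by a value for variable `0`. -/
def consEnv (n : ℕ) (ρ : ℕ → ℕ) : ℕ → ℕ
  | 0 => n
  | k + 1 => ρ k

/-- Satisfaction in the standard model `ℕ`. -/
def Fml.Sat (ρ : ℕ → ℕ) : Fml → Prop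
  | .eq s t => s.val ρ = t.val ρ
  | .ne s t => s.val ρ ≠ t.val ρ
  | .and A B => A.Sat ρ ∧ B.Sat ρ
  | .or A B => A.Sat ρ ∨ B.Sat ρ
  | .all A => ∀ n : ℕ, A.Sat (consEnv n ρ)
  | .ex A => ∃ n : ℕ, A.Sat (consEnv n ρ)

/-- Truth of a sentence in the standard model. -/
def sentTrue (A : Sentence) : Prop := A.1.Sat (fun _ => 0)

/-- Substitution of a closed term `t` for variable `k` in a term. -/
def Trm.sub (t : Trm) (k : ℕ) : Trm → Trm
  | .var i => if i = k then t else if k < i then .var (i - 1) else .var i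
  | .zero => .zero
  | .one => .one
  | .add s u => .add (Trm.sub t k s) (Trm.sub t k u)
  | .mul s u => .mul (Trm.sub t k s) (Trm.sub t k u)

/-- Substitution of a closed term `t` for variable `k` in a formula. -/
def Fml.sub (t : Trm) : Fml → ℕ → Fml
  | .eq s u, k => .eq (Trm.sub t k s) (Trm.sub t k u)
  | .ne s u, k => .ne (Trm.sub t k s) (Trm.sub t k u)
  | .and A B, k => .and (A.sub t k) (B.sub t k)
  | .or A B, k => .or (A.sub t k) (B.sub t k)
  | .all A, k => .all (A.sub t (k + 1))
  | .ex A, k => .ex (A.sub t (k + 1))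

/-- The numeral `n̄`. -/
def numeral : ℕ → Trm
  | 0 => .zero
  | n + 1 => .add (numeral n) .one

theorem Trm.cu_mono : ∀ (t : Trm) {j k : ℕ}, j ≤ k → t.cu j = true → t.cu k = true := by
  intro t
  induction t with
  | var i =>
    intro j k h ht
    simp only [Trm.cu, decide_eq_true_eq] at *
    omega
  | zero => intros; rfl
  | one => intros; rfl
  | add s u ihs ihu =>
    intro j k h ht
    simp only [Trm.cu, Bool.and_eq_true] at *
    exact ⟨ihs h ht.1, ihu h ht.2⟩
  | mul s u ihs ihu =>
    intro j k h ht
    simp only [Trm.cu, Bool.and_eq_true] at *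
    exact ⟨ihs h ht.1, ihu h ht.2⟩

theorem Trm.cu_sub : ∀ (s : Trm) {k : ℕ} {t : Trm},
    t.cu 0 = true → s.cu (k + 1) = true → (Trm.sub t k s).cu k = true := by
  intro s
  induction s with
  | var i =>
    intro k t ht hs
    simp only [Trm.cu, decide_eq_true_eq] at hs
    simp only [Trm.sub]
    by_cases h : i = k
    · rw [if_pos h]
      exact Trm.cu_mono t (Nat.zero_le k) ht
    · have h2 : ¬ k < i := by omega
      rw [if_neg h, if_neg h2]
      simp only [Trm.cu, decide_eq_true_eq]
      omega
  | zero => intros; rfl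
  | one => intros; rfl
  | add s u ihs ihu =>
    intro k t ht hs
    simp only [Trm.cu, Bool.and_eq_true] at hs
    simp only [Trm.sub, Trm.cu, Bool.and_eq_true]
    exact ⟨ihs ht hs.1, ihu ht hs.2⟩
  | mul s u ihs ihu =>
    intro k t ht hs
    simp only [Trm.cu, Bool.and_eq_true] at hs
    simp only [Trm.sub, Trm.cu, Bool.and_eq_true]
    exact ⟨ihs ht hs.1, ihu ht hs.2⟩

theorem Fml.cu_sub : ∀ (A : Fml) {k : ℕ} {t : Trm},
    t.cu 0 = true → A.cu (k + 1) = true → (A.sub t k).cu k = true := by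
  intro A
  induction A with
  | eq s u =>
    intro k t ht hA
    simp only [Fml.cu, Bool.and_eq_true] at hA
    simp only [Fml.sub, Fml.cu, Bool.and_eq_true]
    exact ⟨Trm.cu_sub s ht hA.1, Trm.cu_sub u ht hA.2⟩
  | ne s u =>
    intro k t ht hA
    simp only [Fml.cu, Bool.and_eq_true] at hA
    simp only [Fml.sub, Fml.cu, Bool.and_eq_true]
    exact ⟨Trm.cu_sub s ht hA.1, Trm.cu_sub u ht hA.2⟩
  | and A B ihA ihB =>
    intro k t ht h
    simp only [Fml.cu, Bool.and_eq_true] at h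
    simp only [Fml.sub, Fml.cu, Bool.and_eq_true]
    exact ⟨ihA ht h.1, ihB ht h.2⟩
  | or A B ihA ihB =>
    intro k t ht h
    simp only [Fml.cu, Bool.and_eq_true] at h
    simp only [Fml.sub, Fml.cu, Bool.and_eq_true]
    exact ⟨ihA ht h.1, ihB ht h.2⟩
  | all A ihA =>
    intro k t ht h
    simp only [Fml.cu] at h
    simp only [Fml.sub, Fml.cu]
    exact ihA ht h
  | ex A ihA =>
    intro k t ht h
    simp only [Fml.cu] at h
    simp only [Fml.sub, Fml.cu]
    exact ihA ht h

theorem numeral_cu : ∀ n : ℕ, (numeral n).cu 0 = true := by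
  intro n
  induction n with
  | zero => rfl
  | succ n ih => simp [numeral, Trm.cu, ih]

/-- Negation (de Morgan dual) of a formula in negation normal form. -/
def Fml.neg : Fml → Fml
  | .eq s t => .ne s t
  | .ne s t => .eq s t
  | .and A B => .or A.neg B.neg
  | .or A B => .and A.neg B.neg
  | .all A => .ex A.neg
  | .ex A => .all A.neg

theorem Fml.cu_neg : ∀ (A : Fml) {k : ℕ}, A.cu k = true → A.neg.cu k = true := by
  intro A
  induction A with
  | eq s u => intro k h; simpa [Fml.cu, Fml.neg] using h
  | ne s u => intro k h; simpa [Fml.cu, Fml.neg] using h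
  | and A B ihA ihB =>
    intro k h
    simp only [Fml.cu, Bool.and_eq_true] at h
    simp only [Fml.neg, Fml.cu, Bool.and_eq_true]
    exact ⟨ihA h.1, ihB h.2⟩
  | or A B ihA ihB =>
    intro k h
    simp only [Fml.cu, Bool.and_eq_true] at h
    simp only [Fml.neg, Fml.cu, Bool.and_eq_true]
    exact ⟨ihA h.1, ihB h.2⟩
  | all A ihA =>
    intro k h
    simp only [Fml.cu] at h
    simp only [Fml.neg, Fml.cu]
    exact ihA h
  | ex A ihA =>
    intro k h
    simp only [Fml.cu] at h
    simp only [Fml.neg, Fml.cu]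
    exact ihA h

/-- Conjunction of sentences. -/
def sAnd (A B : Sentence) : Sentence :=
  ⟨.and A.1 B.1, by simp [Fml.cu, A.2, B.2]⟩

/-- Disjunction of sentences. -/
def sOr (A B : Sentence) : Sentence :=
  ⟨.or A.1 B.1, by simp [Fml.cu, A.2, B.2]⟩

/-- Negation of a sentence. -/
def sNeg (A : Sentence) : Sentence := ⟨A.1.neg, Fml.cu_neg A.1 A.2⟩

/-- The sentence `∀x A(x)`, for `A` with (at most) one free variable. -/
def sAll (A : Fml) (h : A.cu 1 = true) : Sentence := ⟨.all A, by simpa [Fml.cu] using h⟩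

/-- The sentence `∃x A(x)`, for `A` with (at most) one free variable. -/
def sEx (A : Fml) (h : A.cu 1 = true) : Sentence := ⟨.ex A, by simpa [Fml.cu] using h⟩

/-- The instance `A(n̄)` of a formula `A` with one free variable. -/
def sInst (A : Fml) (h : A.cu 1 = true) (n : ℕ) : Sentence :=
  ⟨A.sub (numeral n) 0, Fml.cu_sub A (numeral_cu n) h⟩

/-- Literals: atomic and negated atomic formulas. -/
def Fml.isLiteral : Fml → Bool
  | .eq _ _ => true
  | .ne _ _ => true
  | _ => false

/-- Quantifier free formulas. -/
def Fml.qf : Fml → Bool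
  | .eq _ _ => true
  | .ne _ _ => true
  | .and A B => A.qf && B.qf
  | .or A B => A.qf && B.qf
  | .all _ => false
  | .ex _ => false

/-- An axiom is a sequent containing a true closed literal. -/
def IsAxiom (Γ : Finset Sentence) : Prop :=
  ∃ A ∈ Γ, A.1.isLiteral = true ∧ sentTrue A

/-- A sequent is true if some member is true. -/
def SeqTrue (Γ : Finset Sentence) : Prop := ∃ A ∈ Γ, sentTrue A


/-! ### A primitive recursive Gödel numbering of terms, sentences and sequents -/

/-- Gödel number of a term. -/
def Trm.enc : Trm → ℕ
  | .var i => 5 * i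
  | .zero => 1
  | .one => 2
  | .add s t => 5 * Nat.pair s.enc t.enc + 3
  | .mul s t => 5 * Nat.pair s.enc t.enc + 4

/-- Fuelled decoding of terms. -/
def Trm.dec : ℕ → ℕ → Option Trm
  | 0, _ => none
  | fuel + 1, n =>
    if n % 5 = 0 then some (.var (n / 5))
    else if n % 5 = 1 then some .zero
    else if n % 5 = 2 then some .one
    else if n % 5 = 3 then
      match Trm.dec fuel (n / 5).unpair.1, Trm.dec fuel (n / 5).unpair.2 with
      | some s, some t => some (.add s t)
      | _, _ => none
    else
      match Trm.dec fuel (n / 5).unpair.1, Trm.dec fuel (n / 5).unpair.2 with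
      | some s, some t => some (.mul s t)
      | _, _ => none

theorem Trm.dec_enc : ∀ (t : Trm) (fuel : ℕ), t.enc < fuel → Trm.dec fuel t.enc = some t := by
  intro t
  induction t with
  | var i =>
    intro fuel h
    match fuel with
    | f + 1 =>
      have h0 : (5 * i) % 5 = 0 := by omega
      have h1 : (5 * i) / 5 = i := by omega
      simp [Trm.dec, Trm.enc, h0, h1]
  | zero =>
    intro fuel h
    match fuel with
    | f + 1 => simp [Trm.dec, Trm.enc]
  | one =>
    intro fuel h
    match fuel with
    | f + 1 => simp [Trm.dec, Trm.enc]
  | add s u ihs ihu =>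
    intro fuel h
    match fuel with
    | f + 1 =>
      simp only [Trm.enc] at h ⊢
      set p := Nat.pair s.enc u.enc with hp
      have h0 : (5 * p + 3) % 5 = 3 := by omega
      have h1 : (5 * p + 3) / 5 = p := by omega
      have hs : s.enc < f := by
        have := Nat.left_le_pair s.enc u.enc
        omega
      have hu : u.enc < f := by
        have := Nat.right_le_pair s.enc u.enc
        omega
      simp only [Trm.dec, h0, h1]
      rw [hp, Nat.unpair_pair, ihs f hs, ihu f hu]
      simp
  | mul s u ihs ihu =>
    intro fuel h
    match fuel with
    | f + 1 =>
      simp only [Trm.enc] at h ⊢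
      set p := Nat.pair s.enc u.enc with hp
      have h0 : (5 * p + 4) % 5 = 4 := by omega
      have h1 : (5 * p + 4) / 5 = p := by omega
      have hs : s.enc < f := by
        have := Nat.left_le_pair s.enc u.enc
        omega
      have hu : u.enc < f := by
        have := Nat.right_le_pair s.enc u.enc
        omega
      simp only [Trm.dec, h0, h1]
      rw [hp, Nat.unpair_pair, ihs f hs, ihu f hu]
      simp

instance : Encodable Trm :=
  ⟨Trm.enc, fun n => Trm.dec (n + 1) n, fun t => Trm.dec_enc t _ (Nat.lt_succ_self _)⟩

/-- Gödel number of a formula. -/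
def Fml.enc : Fml → ℕ
  | .eq s t => 6 * Nat.pair s.enc t.enc
  | .ne s t => 6 * Nat.pair s.enc t.enc + 1
  | .and A B => 6 * Nat.pair A.enc B.enc + 2
  | .or A B => 6 * Nat.pair A.enc B.enc + 3
  | .all A => 6 * A.enc + 4
  | .ex A => 6 * A.enc + 5

/-- Fuelled decoding of formulas. -/
def Fml.dec : ℕ → ℕ → Option Fml
  | 0, _ => none
  | fuel + 1, n =>
    if n % 6 = 0 then
      match Encodable.decode (α := Trm) (n / 6).unpair.1,
            Encodable.decode (α := Trm) (n / 6).unpair.2 with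
      | some s, some t => some (.eq s t)
      | _, _ => none
    else if n % 6 = 1 then
      match Encodable.decode (α := Trm) (n / 6).unpair.1,
            Encodable.decode (α := Trm) (n / 6).unpair.2 with
      | some s, some t => some (.ne s t)
      | _, _ => none
    else if n % 6 = 2 then
      match Fml.dec fuel (n / 6).unpair.1, Fml.dec fuel (n / 6).unpair.2 with
      | some A, some B => some (.and A B)
      | _, _ => none
    else if n % 6 = 3 then
      match Fml.dec fuel (n / 6).unpair.1, Fml.dec fuel (n / 6).unpair.2 with
      | some A, some B => some (.or A B)
      | _, _ => none
    else if n % 6 = 4 then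
      match Fml.dec fuel (n / 6) with
      | some A => some (.all A)
      | none => none
    else
      match Fml.dec fuel (n / 6) with
      | some A => some (.ex A)
      | none => none

theorem Fml.dec_enc : ∀ (A : Fml) (fuel : ℕ), A.enc < fuel → Fml.dec fuel A.enc = some A := by
  intro A
  induction A with
  | eq s u =>
    intro fuel h
    match fuel with
    | f + 1 =>
      simp only [Fml.enc] at h ⊢
      set p := Nat.pair s.enc u.enc with hp
      have h0 : (6 * p) % 6 = 0 := by omega
      have h1 : (6 * p) / 6 = p := by omega
      have hds : Encodable.decode (α := Trm) s.enc = some s := Encodable.encodek s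
      have hdu : Encodable.decode (α := Trm) u.enc = some u := Encodable.encodek u
      simp only [Fml.dec, h0, h1]
      rw [hp, Nat.unpair_pair, hds, hdu]
      simp
  | ne s u =>
    intro fuel h
    match fuel with
    | f + 1 =>
      simp only [Fml.enc] at h ⊢
      set p := Nat.pair s.enc u.enc with hp
      have h0 : (6 * p + 1) % 6 = 1 := by omega
      have h1 : (6 * p + 1) / 6 = p := by omega
      have hds : Encodable.decode (α := Trm) s.enc = some s := Encodable.encodek s
      have hdu : Encodable.decode (α := Trm) u.enc = some u := Encodable.encodek u
      simp only [Fml.dec, h0, h1]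
      rw [hp, Nat.unpair_pair, hds, hdu]
      simp
  | and A B ihA ihB =>
    intro fuel h
    match fuel with
    | f + 1 =>
      simp only [Fml.enc] at h ⊢
      set p := Nat.pair A.enc B.enc with hp
      have h0 : (6 * p + 2) % 6 = 2 := by omega
      have h1 : (6 * p + 2) / 6 = p := by omega
      have hA : A.enc < f := by
        have := Nat.left_le_pair A.enc B.enc
        omega
      have hB : B.enc < f := by
        have := Nat.right_le_pair A.enc B.enc
        omega
      simp only [Fml.dec, h0, h1]
      rw [hp, Nat.unpair_pair, ihA f hA, ihB f hB]
      simp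
  | or A B ihA ihB =>
    intro fuel h
    match fuel with
    | f + 1 =>
      simp only [Fml.enc] at h ⊢
      set p := Nat.pair A.enc B.enc with hp
      have h0 : (6 * p + 3) % 6 = 3 := by omega
      have h1 : (6 * p + 3) / 6 = p := by omega
      have hA : A.enc < f := by
        have := Nat.left_le_pair A.enc B.enc
        omega
      have hB : B.enc < f := by
        have := Nat.right_le_pair A.enc B.enc
        omega
      simp only [Fml.dec, h0, h1]
      rw [hp, Nat.unpair_pair, ihA f hA, ihB f hB]
      simp
  | all A ihA =>
    intro fuel h
    match fuel with
    | f + 1 =>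
      simp only [Fml.enc] at h ⊢
      have h0 : (6 * A.enc + 4) % 6 = 4 := by omega
      have h1 : (6 * A.enc + 4) / 6 = A.enc := by omega
      have hA : A.enc < f := by omega
      simp [Fml.dec, h0, h1, ihA f hA]
  | ex A ihA =>
    intro fuel h
    match fuel with
    | f + 1 =>
      simp only [Fml.enc] at h ⊢
      have h0 : (6 * A.enc + 5) % 6 = 5 := by omega
      have h1 : (6 * A.enc + 5) / 6 = A.enc := by omega
      have hA : A.enc < f := by omega
      simp [Fml.dec, h0, h1, ihA f hA]

instance : Encodable Fml :=
  ⟨Fml.enc, fun n => Fml.dec (n + 1) n, fun A => Fml.dec_enc A _ (Nat.lt_succ_self _)⟩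

/-- Gödel number of a sentence. -/
def encF (A : Sentence) : ℕ := Encodable.encode A

/-- Gödel number of a sequent (finite set of sentences). -/
def encS (Γ : Finset Sentence) : ℕ := Encodable.encode Γ

/-- Decode a Gödel number into a sentence (with a default value). -/
def decF (n : ℕ) : Sentence := (Encodable.decode (α := Sentence) n).getD ⟨.eq .zero .zero, rfl⟩

/-- Decode a Gödel number into a sequent (with a default value). -/
def decS (n : ℕ) : Finset Sentence := (Encodable.decode (α := Finset Sentence) n).getD ∅

/-! ### Tupling of natural numbers, with projections -/

/-- Code of a finite sequence (tuple) of natural numbers; codes are nonzero. -/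
def tup (l : List ℕ) : ℕ := Encodable.encode l + 1

/-- The finite sequence coded by a natural number. -/
def untup (a : ℕ) : List ℕ := Denumerable.ofNat (List ℕ) (a - 1)

/-- The `i`-th projection `(a)_i`. -/
def proj (a i : ℕ) : ℕ := (untup a).getD i 0

/-- `a` codes a finite sequence (every nonzero number does, bijectively). -/
def InSeq (a : ℕ) : Prop := a ≠ 0

/-- The code of the empty sequence `⟨⟩` (the root). -/
def rootSeq : ℕ := tup []

/-- The code of `σ⌢i`. -/
def snoc (σ i : ℕ) : ℕ := tup (untup σ ++ [i])

/-! ### Names for the inference rules -/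

def axC : ℕ := 1
def andC : ℕ := 2
def orC : ℕ := 3
def omC : ℕ := 4
def exC : ℕ := 5
def cutC : ℕ := 6
def omrepC : ℕ := 7

/-- The end sequent of a (code of a) proof or proof node: `(a)_1` if the rule
`(a)_0` carries no main formula, and `(a)_1 ∪ {(a)_2}` otherwise. -/
def EndS (a : ℕ) : Finset Sentence :=
  if proj a 0 = cutC ∨ proj a 0 = axC ∨ proj a 0 = omrepC then decS (proj a 1)
  else decS (proj a 1) ∪ {decF (proj a 2)}

/-! ### Local codes of ω-proofs -/

/-- Local codes of `ω`-proofs, in Tait style.  The three `Bool` parameters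
respectively allow the cut rule, restrict the `ω`-rule to indices of primitive
recursive functions, and allow the vacuous `ω`-repetition rule. -/
inductive CGen (c p r : Bool) : ℕ → Prop
  | ax (Γ : Finset Sentence) (h : IsAxiom Γ) : CGen c p r (tup [axC, encS Γ])
  | and {a b : ℕ} (Γ : Finset Sentence) (A B : Sentence)
      (ha : CGen c p r a) (hb : CGen c p r b)
      (ea : EndS a = Γ ∪ {A}) (eb : EndS b = Γ ∪ {B}) :
      CGen c p r (tup [andC, encS Γ, encF (sAnd A B), a, b])
  | or {a : ℕ} (Γ : Finset Sentence) (A B : Sentence) (ha : CGen c p r a)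
      (ea : EndS a = Γ ∪ {A, B}) :
      CGen c p r (tup [orC, encS Γ, encF (sOr A B), a])
  | om {e : ℕ} (Γ : Finset Sentence) (A : Fml) (hA : A.cu 1 = true)
      (hp : p = true → PrimIndex e)
      (htot : ∀ n, (peval e n).Dom)
      (hmem : ∀ n, CGen c p r ((peval e n).get (htot n)))
      (hend : ∀ n, EndS ((peval e n).get (htot n)) = Γ ∪ {sInst A hA n}) :
      CGen c p r (tup [omC, encS Γ, encF (sAll A hA), e])
  | ex {a : ℕ} (Γ : Finset Sentence) (A : Fml) (hA : A.cu 1 = true) (n : ℕ)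
      (ha : CGen c p r a) (ea : EndS a = Γ ∪ {sInst A hA n}) :
      CGen c p r (tup [exC, encS Γ, encF (sEx A hA), a])
  | cut {a b : ℕ} (hc : c = true) (Γ : Finset Sentence) (C : Sentence)
      (ha : CGen c p r a) (hb : CGen c p r b)
      (ea : EndS a = Γ ∪ {C}) (eb : EndS b = Γ ∪ {sNeg C}) :
      CGen c p r (tup [cutC, encS Γ, encF C, a, b])
  | omrep {e : ℕ} (hr : r = true) (Γ : Finset Sentence) (hp : PrimIndex e)
      (htot : ∀ n, (peval e n).Dom)
      (hmem : ∀ n, CGen c p r ((peval e n).get (htot n)))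
      (hend : ∀ n, EndS ((peval e n).get (htot n)) = Γ) :
      CGen c p r (tup [omrepC, encS Γ, e])

/-- `C_rec`: recursive local codes of `ω`-proofs. -/
def Crec : ℕ → Prop := CGen true false false

/-- `C_rec^-`: the cut free fragment of `C_rec`. -/
def CrecM : ℕ → Prop := CGen false false false

/-- `C_prec`: primitive recursive local codes of `ω`-proofs. -/
def Cprec : ℕ → Prop := CGen true true false

/-- `C_prec^-`: the cut free fragment of `C_prec`. -/
def CprecM : ℕ → Prop := CGen false true false

/-- `C_prec^{ω-rep}`: `C_prec` with the vacuous `ω`-repetition rule. -/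
def CprecRep : ℕ → Prop := CGen true true true

/-! ### ω-proofs as well founded trees of sequents -/

/-- `σ` is a node of the tree `T_π = {σ ∈ Seq : π(σ) ∈ Seq}`. -/
def TreeOf (π : ℕ → ℕ) (σ : ℕ) : Prop := σ ≠ 0 ∧ π σ ≠ 0

/-- The tree `T_π` is well founded: it has no infinite branch. -/
def WFTree (π : ℕ → ℕ) : Prop :=
  ¬ ∃ f : ℕ → ℕ, ∀ n : ℕ, TreeOf π (tup ((List.range n).map f))

/-- The inference at an inner node of an `ω`-proof is a correct instance of one
of the rules of Tait-style `ω`-arithmetic. -/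
def CorrectInner (π : ℕ → ℕ) (σ : ℕ) : Prop :=
  (∃ (Γ : Finset Sentence) (A B : Sentence),
    π σ = tup [andC, encS Γ, encF (sAnd A B)] ∧
    TreeOf π (snoc σ 0) ∧ TreeOf π (snoc σ 1) ∧ ¬ TreeOf π (snoc σ 2) ∧
    EndS (π (snoc σ 0)) = Γ ∪ {A} ∧ EndS (π (snoc σ 1)) = Γ ∪ {B}) ∨
  (∃ (Γ : Finset Sentence) (A B : Sentence),
    π σ = tup [orC, encS Γ, encF (sOr A B)] ∧
    TreeOf π (snoc σ 0) ∧ ¬ TreeOf π (snoc σ 1) ∧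
    EndS (π (snoc σ 0)) = Γ ∪ {A, B}) ∨
  (∃ (Γ : Finset Sentence) (A : Fml) (hA : A.cu 1 = true),
    π σ = tup [omC, encS Γ, encF (sAll A hA)] ∧
    (∀ n : ℕ, TreeOf π (snoc σ n)) ∧
    (∀ n : ℕ, EndS (π (snoc σ n)) = Γ ∪ {sInst A hA n})) ∨
  (∃ (Γ : Finset Sentence) (A : Fml) (hA : A.cu 1 = true) (n : ℕ),
    π σ = tup [exC, encS Γ, encF (sEx A hA)] ∧
    TreeOf π (snoc σ 0) ∧ ¬ TreeOf π (snoc σ 1) ∧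
    EndS (π (snoc σ 0)) = Γ ∪ {sInst A hA n}) ∨
  (∃ (Γ : Finset Sentence) (C : Sentence),
    π σ = tup [cutC, encS Γ, encF C] ∧
    TreeOf π (snoc σ 0) ∧ TreeOf π (snoc σ 1) ∧ ¬ TreeOf π (snoc σ 2) ∧
    EndS (π (snoc σ 0)) = Γ ∪ {C} ∧ EndS (π (snoc σ 1)) = Γ ∪ {sNeg C})

/-- Local correctness of a function `π : ℕ → ℕ` viewed as a tree of sequents:
all conditions in the definition of `ω`-proof except well-foundedness. -/
structure LocallyCorrect (π : ℕ → ℕ) : Prop where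
  /-- values outside `Seq` are `0` -/
  nonseq : ∀ σ, ¬ InSeq (π σ) → π σ = 0
  /-- `T_π` is closed under initial segments -/
  downward : ∀ σ τ, TreeOf π σ → τ ≠ 0 → untup τ <+: untup σ → TreeOf π τ
  /-- children come first -/
  mono : ∀ σ i j, i < j → TreeOf π (snoc σ j) → TreeOf π (snoc σ i)
  /-- top nodes are axioms -/
  top : ∀ σ, TreeOf π σ → ¬ TreeOf π (snoc σ 0) →
    ∃ Γ : Finset Sentence, IsAxiom Γ ∧ π σ = tup [axC, encS Γ]
  /-- inner nodes are correct inferences -/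
  inner : ∀ σ, TreeOf π σ → TreeOf π (snoc σ 0) → CorrectInner π σ

/-- `π : ℕ → ℕ` is an `ω`-proof. -/
structure IsOmegaProof (π : ℕ → ℕ) extends LocallyCorrect π : Prop where
  /-- the tree `T_π` is well founded -/
  wf : WFTree π

/-- An `ω`-proof is cut free if no node is labelled `cut`. -/
def CutFree (π : ℕ → ℕ) : Prop := ∀ σ, TreeOf π σ → proj (π σ) 0 ≠ cutC

/-! ### The ω-proof `π(a)` coded by a local code `a` -/

open Classical in
/-- The code of the subproof at child `n` of the proof coded by `a`. -/
noncomputable def childCode (a n : ℕ) : ℕ :=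
  if proj a 0 = omC then
    (if h : (peval (proj a 3) n).Dom then (peval (proj a 3) n).get h else 0)
  else if proj a 0 = andC ∨ proj a 0 = orC ∨ proj a 0 = exC ∨ proj a 0 = cutC then
    proj a (n + 3)
  else 0

/-- Walk down a local code along a path. -/
noncomputable def walkCode (a : ℕ) : List ℕ → ℕ
  | [] => a
  | i :: l => walkCode (childCode a i) l

/-- The node label `⟨R,Γ,A⟩` (or `⟨Ax,Γ⟩`) determined by a local code. -/
def nodeVal (b : ℕ) : ℕ :=
  if proj b 0 = axC then tup [axC, proj b 1]
  else if proj b 0 = andC ∨ proj b 0 = orC ∨ proj b 0 = omC ∨ proj b 0 = exC ∨ proj b 0 = cutC then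
    tup [proj b 0, proj b 1, proj b 2]
  else 0

/-- The `ω`-proof `π(a)` determined by a local code `a` (with value `0` at all
other arguments). -/
noncomputable def piOf (a : ℕ) (σ : ℕ) : ℕ :=
  if σ = 0 then 0 else nodeVal (walkCode a (untup σ))

/-! ### Indices (global codes) of recursive and primitive recursive ω-proofs -/

/-- `I_rec`: `a` is an index of a recursive `ω`-proof. -/
def Irec (a : ℕ) : Prop :=
  ∃ h : ∀ n, (peval a n).Dom, IsOmegaProof (fun n => (peval a n).get (h n))

/-- `I_prec`: `a` is an index of a primitive recursive `ω`-proof. -/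
def Iprec (a : ℕ) : Prop :=
  ∃ f : ℕ → ℕ, Nat.Primrec f ∧ (∀ n, peval a n = Part.some (f n)) ∧ IsOmegaProof f

/-- `I_prec^-`: `a` is an index of a primitive recursive cut free `ω`-proof. -/
def IprecM (a : ℕ) : Prop :=
  ∃ f : ℕ → ℕ, Nat.Primrec f ∧ (∀ n, peval a n = Part.some (f n)) ∧
    IsOmegaProof f ∧ CutFree f

/-! ### Ordinal lengths -/

open Classical in
/-- `x + 1` if `P` holds, and `0` otherwise. -/
noncomputable def succIf (P : Prop) (x : Ordinal.{0}) : Ordinal.{0} :=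
  if P then x + 1 else 0

/-- The ordinal rank of a node of the tree `T_π`:
`rank σ = sup {rank (σ⌢i) + 1 : σ⌢i ∈ T_π}`. -/
inductive NodeRank (π : ℕ → ℕ) : ℕ → Ordinal.{0} → Prop
  | mk (σ : ℕ) (o : ℕ → Ordinal.{0})
      (h : ∀ i, TreeOf π (snoc σ i) → NodeRank π (snoc σ i) (o i)) :
      NodeRank π σ (⨆ i, succIf (TreeOf π (snoc σ i)) (o i))

/-- The ordinal length of a local code:  `|⟨Ax,Γ⟩| = 0`,
`|⟨R,Γ,A,a₁,…,a_k⟩| = sup{|a₁|,…,|a_k|} + 1`, and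
`|⟨ω,Γ,∀xA(x),e⟩| = sup{|⟨e⟩(n)| + 1 : n ∈ ℕ}`. -/
inductive CLen : ℕ → Ordinal.{0} → Prop
  | ax (g : ℕ) : CLen (tup [axC, g]) 0
  | one (R g x a : ℕ) (o : Ordinal.{0}) (hR : R = orC ∨ R = exC) (h : CLen a o) :
      CLen (tup [R, g, x, a]) (o + 1)
  | two (R g x a b : ℕ) (oa ob : Ordinal.{0}) (hR : R = andC ∨ R = cutC)
      (ha : CLen a oa) (hb : CLen b ob) :
      CLen (tup [R, g, x, a, b]) ((oa ⊔ ob) + 1)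
  | om (g x e : ℕ) (h : ∀ n, (peval e n).Dom) (o : ℕ → Ordinal.{0})
      (ho : ∀ n, CLen ((peval e n).get (h n)) (o n)) :
      CLen (tup [omC, g, x, e]) (⨆ n, o n + 1)

/-- The ordinal `|a|` of a notation `a ∈ O`:  `|1| = 0`, `|2^a| = |a| + 1`,
`|3·5^e| = sup{|⟨e⟩(n)| : n ∈ ℕ}`. -/
inductive KOrd : ℕ → Ordinal.{0} → Prop
  | one : KOrd 1 0
  | step {a : ℕ} {o : Ordinal.{0}} : KOrd a o → KOrd (2 ^ a) (o + 1)
  | lim {e : ℕ} (h : ∀ n, (peval e n).Dom) (o : ℕ → Ordinal.{0})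
      (ho : ∀ n, KOrd ((peval e n).get (h n)) (o n)) :
      KOrd (3 * 5 ^ e) (⨆ n, o n)


open Classical in
/-- One step of the sequence `a(f)` determined by a local code. -/
noncomputable def branchStep (b k : ℕ) : Option ℕ :=
  if (∃ (Γ : Finset Sentence) (A B : Sentence) (b₀ b₁ : ℕ),
        b = tup [andC, encS Γ, encF (sAnd A B), b₀, b₁]) ∨
     (∃ (Γ : Finset Sentence) (C : Sentence) (b₀ b₁ : ℕ),
        b = tup [cutC, encS Γ, encF C, b₀, b₁]) then
    some (proj b (3 + k % 2))
  else if ∃ (Γ : Finset Sentence) (A B : Sentence) (c : ℕ),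
      b = tup [orC, encS Γ, encF (sOr A B), c] then
    some (proj b 3)
  else if ∃ (Γ : Finset Sentence) (A : Fml) (hA : A.cu 1 = true) (e : ℕ),
      b = tup [omC, encS Γ, encF (sAll A hA), e] then
    (if h : (peval (proj b 3) k).Dom then some ((peval (proj b 3) k).get h) else none)
  else none

/-- The sequence `a(f) = ⟨a₀,a₁,…⟩`:  `chain a f i = some aᵢ` if the `i`-th
element of the sequence is defined, and `none` otherwise. -/
noncomputable def chain (a : ℕ) (f : ℕ → ℕ) : ℕ → Option ℕ
  | 0 => some a
  | i + 1 =>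
    match chain a f i with
    | none => none
    | some b => branchStep b (f i)

/-! ### Codes of sequents -/

open Encodable in
/-- The code of a finite set is the code of the list of its elements, sorted by code. -/
theorem encode_finset_eq_encode_sorted {α : Type*} [Encodable α] (s : Finset α) :
    ∃ l : List α, encode s = encode l ∧ (l : Multiset α) = s.1 ∧
      l.Pairwise (fun a b => encode a ≤ encode b) := by
  obtain ⟨⟨l⟩, h⟩ := s
  refine ⟨l.mergeSort (fun a b => decide (encode a ≤ encode b)), ?_, ?_, ?_⟩
  · change encode (l.mergeSort _) = _
    congr 2
  · exact Quot.sound (List.mergeSort_perm _ _)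
  · have := List.pairwise_mergeSort (le := fun a b : α => decide (encode a ≤ encode b))
      (fun a b c => by simpa using le_trans) (fun a b => by simpa using le_total _ _) l
    simpa using this

theorem encode_map_encode {α : Type*} [Encodable α] (l : List α) :
    Encodable.encode (l.map Encodable.encode) = Encodable.encode l := by
  induction l with
  | nil => rfl
  | cons a l ih => simp [Encodable.encode_list_cons, ih]

/-- The strictly increasing list of the codes of the members of a sequent. -/
def codeList (Γ : Finset Sentence) : List ℕ := (Γ.image encF).sort (· ≤ ·)

theorem encS_eq_encode_codeList (Γ : Finset Sentence) :
    encS Γ = Encodable.encode (codeList Γ) := by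
  obtain ⟨l, hl, hΓ, hsort⟩ := encode_finset_eq_encode_sorted Γ
  have hmem : ∀ x, x ∈ l ↔ x ∈ Γ := fun x => by
    rw [← Multiset.mem_coe, hΓ]
    rfl
  have hnd : l.Nodup := by
    rw [← Multiset.coe_nodup, hΓ]
    exact Γ.2
  rw [encS, hl, ← encode_map_encode, codeList]
  congr 1
  refine List.Perm.eq_of_pairwise' (r := (· ≤ ·)) (List.pairwise_map.2 hsort)
    (Finset.pairwise_sort _ _) ?_
  refine (List.perm_ext_iff_of_nodup (hnd.map Encodable.encode_injective)
    (Finset.sort_nodup _ _)).2 fun n => ?_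
  simp [hmem, encF]

/-- Insertion into a strictly increasing list. -/
def insertCode (n : ℕ) (l : List ℕ) : List ℕ :=
  l.filter (· < n) ++ n :: l.filter (n < ·)

theorem codeList_insert (Γ : Finset Sentence) (A : Sentence) :
    codeList (insert A Γ) = insertCode (encF A) (codeList Γ) := by
  have hs : (codeList Γ).Pairwise (· < ·) := Finset.sortedLT_sort _ |>.pairwise
  have hs' : (insertCode (encF A) (codeList Γ)).Pairwise (· < ·) := by
    refine List.pairwise_append.2 ⟨hs.filter _, List.pairwise_cons.2 ⟨?_, hs.filter _⟩, ?_⟩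
    · simp
    · intro a ha b hb
      simp only [List.mem_filter, decide_eq_true_eq, List.mem_cons] at ha hb
      rcases hb with rfl | hb
      · exact ha.2
      · exact ha.2.trans hb.2
  refine List.Perm.eq_of_pairwise' (r := (· ≤ ·)) (Finset.pairwise_sort _ _)
    (hs'.imp le_of_lt) ?_
  refine (List.perm_ext_iff_of_nodup (Finset.sort_nodup _ _) (hs'.imp ne_of_lt)).2 fun n => ?_
  simp only [Finset.mem_sort, Finset.image_insert, Finset.mem_insert, insertCode, codeList,
    List.mem_append, List.mem_filter, decide_eq_true_eq, List.mem_cons]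
  rcases lt_trichotomy n (encF A) with h | h | h
  · simp [h, h.ne, h.not_gt]
  · simp [h]
  · simp [h, h.ne', h.not_gt]

theorem primrec_insertCode : Primrec₂ insertCode := by
  have h₁ : Primrec₂ fun (l : List ℕ) (n : ℕ) => l.filter (fun a => a < n) :=
    PrimrecRel.listFilter Primrec.nat_lt
  have h₂ : Primrec₂ fun (l : List ℕ) (n : ℕ) => l.filter (fun a => n < a) :=
    PrimrecRel.listFilter (R := fun a n => n < a) (Primrec.nat_lt.swap)
  exact Primrec.list_append.comp (h₁.comp Primrec.snd Primrec.fst)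
    (Primrec.list_cons.comp Primrec.fst (h₂.comp Primrec.snd Primrec.fst))

theorem decS_encS (Γ : Finset Sentence) : decS (encS Γ) = Γ := by simp [decS, encS]

theorem decF_encF (A : Sentence) : decF (encF A) = A := by simp [decF, encF]

/-! ### Tuples -/

theorem untup_tup (l : List ℕ) : untup (tup l) = l := by
  simp [untup, tup]

theorem tup_ne_zero (l : List ℕ) : tup l ≠ 0 := Nat.succ_ne_zero _

theorem proj_tup (l : List ℕ) (i : ℕ) : proj (tup l) i = l.getD i 0 := by
  rw [proj, untup_tup]

theorem proj_zero (i : ℕ) : proj 0 i = 0 := by simp [proj, untup]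

theorem primrec_tup : Primrec tup := Primrec.succ.comp Primrec.encode

theorem primrec_untup : Primrec untup :=
  (Primrec.ofNat (List ℕ)).comp (Primrec.pred)

/-! ### Instantiating formulas by numerals -/

/-- The environment given by a finite list of values (and `0` elsewhere). -/
def listEnv (env : List ℕ) (i : ℕ) : ℕ := env.getD i 0

theorem consEnv_listEnv (n : ℕ) (env : List ℕ) :
    consEnv n (listEnv env) = listEnv (n :: env) := by
  funext i
  cases i <;> simp [consEnv, listEnv]

/-- Replace the variables `d, d + 1, …` of a term by the numerals of the values in `env`. -/
def Trm.close (env : List ℕ) (d : ℕ) : Trm → Trm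
  | .var i => if i < d then .var i else numeral (listEnv env (i - d))
  | .zero => .zero
  | .one => .one
  | .add s t => .add (s.close env d) (t.close env d)
  | .mul s t => .mul (s.close env d) (t.close env d)

/-- Replace the free variables `d, d + 1, …` of a formula by the numerals of the values in
`env`. -/
def Fml.close (env : List ℕ) : Fml → ℕ → Fml
  | .eq s t, d => .eq (s.close env d) (t.close env d)
  | .ne s t, d => .ne (s.close env d) (t.close env d)
  | .and A B, d => .and (A.close env d) (B.close env d)
  | .or A B, d => .or (A.close env d) (B.close env d)
  | .all A, d => .all (A.close env (d + 1))
  | .ex A, d => .ex (A.close env (d + 1))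

theorem Trm.cu_close (env : List ℕ) (d : ℕ) (t : Trm) : (t.close env d).cu d = true := by
  induction t with
  | var i =>
    by_cases h : i < d
    · simp [Trm.close, h, Trm.cu]
    · simpa [Trm.close, h] using Trm.cu_mono _ (Nat.zero_le d) (numeral_cu _)
  | zero => rfl
  | one => rfl
  | add s t hs ht => simp [Trm.close, Trm.cu, hs, ht]
  | mul s t hs ht => simp [Trm.close, Trm.cu, hs, ht]

theorem Fml.cu_close (env : List ℕ) (A : Fml) (d : ℕ) : (A.close env d).cu d = true := by
  induction A generalizing d with
  | eq s t => simp [Fml.close, Fml.cu, Trm.cu_close]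
  | ne s t => simp [Fml.close, Fml.cu, Trm.cu_close]
  | and A B hA hB => simp [Fml.close, Fml.cu, hA, hB]
  | or A B hA hB => simp [Fml.close, Fml.cu, hA, hB]
  | all A hA => simp [Fml.close, Fml.cu, hA]
  | ex A hA => simp [Fml.close, Fml.cu, hA]

theorem Trm.close_of_cu (env : List ℕ) {d : ℕ} {t : Trm} (h : t.cu d = true) :
    t.close env d = t := by
  induction t with
  | var i =>
    simp only [Trm.cu, decide_eq_true_eq] at h
    simp [Trm.close, h]
  | zero => rfl
  | one => rfl
  | add s t hs ht =>
    simp only [Trm.cu, Bool.and_eq_true] at h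
    simp [Trm.close, hs h.1, ht h.2]
  | mul s t hs ht =>
    simp only [Trm.cu, Bool.and_eq_true] at h
    simp [Trm.close, hs h.1, ht h.2]

theorem Fml.close_of_cu (env : List ℕ) {A : Fml} {d : ℕ} (h : A.cu d = true) :
    A.close env d = A := by
  induction A generalizing d with
  | eq s t =>
    simp only [Fml.cu, Bool.and_eq_true] at h
    simp [Fml.close, Trm.close_of_cu env h.1, Trm.close_of_cu env h.2]
  | ne s t =>
    simp only [Fml.cu, Bool.and_eq_true] at h
    simp [Fml.close, Trm.close_of_cu env h.1, Trm.close_of_cu env h.2]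
  | and A B hA hB =>
    simp only [Fml.cu, Bool.and_eq_true] at h
    simp [Fml.close, hA h.1, hB h.2]
  | or A B hA hB =>
    simp only [Fml.cu, Bool.and_eq_true] at h
    simp [Fml.close, hA h.1, hB h.2]
  | all A hA => simp [Fml.close, hA h]
  | ex A hA => simp [Fml.close, hA h]

theorem sub_numeral (t : Trm) (k n : ℕ) : Trm.sub t k (numeral n) = numeral n := by
  induction n with
  | zero => rfl
  | succ n ih => simp [numeral, Trm.sub, ih]

theorem Trm.sub_close (env : List ℕ) (n d : ℕ) (t : Trm) :
    Trm.sub (numeral n) d (t.close env (d + 1)) = t.close (n :: env) d := by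
  induction t with
  | var i =>
    rcases lt_trichotomy i d with h | rfl | h
    · simp [Trm.close, Trm.sub, h, h.ne, h.not_gt, Nat.lt_succ_of_lt h]
    · simp [Trm.close, Trm.sub, listEnv]
    · obtain ⟨j, rfl⟩ := Nat.exists_eq_add_of_lt h
      have h₁ : ¬ d + j + 1 < d + 1 := by omega
      have h₂ : ¬ d + j + 1 < d := by omega
      have h₃ : d + j + 1 - (d + 1) = j := by omega
      have h₄ : d + j + 1 - d = j + 1 := by omega
      simp only [Trm.close, if_neg h₁, if_neg h₂, h₃, h₄, sub_numeral]
      simp [listEnv]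
  | zero => rfl
  | one => rfl
  | add s t hs ht => simp [Trm.close, Trm.sub, hs, ht]
  | mul s t hs ht => simp [Trm.close, Trm.sub, hs, ht]

theorem Fml.sub_close (env : List ℕ) (n : ℕ) (A : Fml) (d : ℕ) :
    (A.close env (d + 1)).sub (numeral n) d = A.close (n :: env) d := by
  induction A generalizing d with
  | eq s t => simp [Fml.close, Fml.sub, Trm.sub_close]
  | ne s t => simp [Fml.close, Fml.sub, Trm.sub_close]
  | and A B hA hB => simp [Fml.close, Fml.sub, hA, hB]
  | or A B hA hB => simp [Fml.close, Fml.sub, hA, hB]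
  | all A hA => simp [Fml.close, Fml.sub, hA]
  | ex A hA => simp [Fml.close, Fml.sub, hA]

theorem val_numeral (ρ : ℕ → ℕ) (n : ℕ) : (numeral n).val ρ = n := by
  induction n with
  | zero => rfl
  | succ n ih => simp [numeral, Trm.val, ih]

theorem Trm.val_close (ρ : ℕ → ℕ) (env : List ℕ) (t : Trm) :
    (t.close env 0).val ρ = t.val (listEnv env) := by
  induction t with
  | var i => simp [Trm.close, Trm.val, val_numeral]
  | zero => rfl
  | one => rfl
  | add s t hs ht => simp [Trm.close, Trm.val, hs, ht]
  | mul s t hs ht => simp [Trm.close, Trm.val, hs, ht]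

/-- The sentence obtained from `A` by substituting the numerals of `env` for its free
variables. -/
def closure (A : Fml) (env : List ℕ) : Sentence := ⟨A.close env 0, A.cu_close env 0⟩

theorem sInst_close (A : Fml) (env : List ℕ) (n : ℕ) :
    sInst (A.close env 1) (A.cu_close env 1) n = closure A (n :: env) :=
  Subtype.ext (A.sub_close env n 0)

/-- Truth of a literal under an environment (`false` for all other formulas). -/
def trueLit (A : Fml) (env : List ℕ) : Bool :=
  match A with
  | .eq s t => decide (s.val (listEnv env) = t.val (listEnv env))
  | .ne s t => !decide (s.val (listEnv env) = t.val (listEnv env))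
  | _ => false

theorem trueLit_iff {A : Fml} (hA : A.isLiteral = true) (env : List ℕ) :
    trueLit A env = true ↔ A.Sat (listEnv env) := by
  cases A <;> simp_all [trueLit, Fml.Sat, Fml.isLiteral]

theorem isAxiom_of_trueLit {Γ : Finset Sentence} {A : Fml} {env : List ℕ}
    (hA : trueLit A env = true) (hΓ : closure A env ∈ Γ) : IsAxiom Γ := by
  refine ⟨_, hΓ, ?_⟩
  cases A <;>
    simp_all [trueLit, Fml.isLiteral, closure, Fml.close, sentTrue, Fml.Sat, Trm.val_close]

/-! ### Primitive recursiveness of instantiation, for a fixed formula -/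

theorem primrec_enc_numeral : Primrec fun n => (numeral n).enc := by
  have h : Primrec₂ fun (_ : ℕ) (m : ℕ) => 5 * Nat.pair m 2 + 3 :=
    (Primrec.nat_add.comp (Primrec.nat_mul.comp (Primrec.const 5)
      (Primrec₂.natPair.comp Primrec.snd (Primrec.const 2))) (Primrec.const 3))
  refine (Primrec.nat_rec₁ (1 : ℕ) h).of_eq fun n => ?_
  induction n with
  | zero => rfl
  | succ n ih => simp [numeral, Trm.enc, ← ih]

theorem Trm.primrec_enc_close (t : Trm) (d : ℕ) : Primrec fun env => (t.close env d).enc := by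
  induction t with
  | var i =>
    by_cases h : i < d
    · simpa [Trm.close, h] using Primrec.const _
    · simpa [Trm.close, h, listEnv] using
        primrec_enc_numeral.comp ((Primrec.list_getD 0).comp Primrec.id (Primrec.const (i - d)))
  | zero => exact Primrec.const _
  | one => exact Primrec.const _
  | add s t hs ht =>
    exact Primrec.nat_add.comp (Primrec.nat_mul.comp (Primrec.const 5)
      (Primrec₂.natPair.comp hs ht)) (Primrec.const 3)
  | mul s t hs ht =>
    exact Primrec.nat_add.comp (Primrec.nat_mul.comp (Primrec.const 5)
      (Primrec₂.natPair.comp hs ht)) (Primrec.const 4)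

theorem Fml.primrec_enc_close (A : Fml) (d : ℕ) : Primrec fun env => (A.close env d).enc := by
  have six {f : List ℕ → ℕ} (hf : Primrec f) (k : ℕ) : Primrec fun env => 6 * f env + k :=
    Primrec.nat_add.comp (Primrec.nat_mul.comp (Primrec.const 6) hf) (Primrec.const k)
  induction A generalizing d with
  | eq s t =>
    exact six (Primrec₂.natPair.comp (s.primrec_enc_close d) (t.primrec_enc_close d)) 0
  | ne s t =>
    exact six (Primrec₂.natPair.comp (s.primrec_enc_close d) (t.primrec_enc_close d)) 1
  | and A B hA hB => exact six (Primrec₂.natPair.comp (hA d) (hB d)) 2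
  | or A B hA hB => exact six (Primrec₂.natPair.comp (hA d) (hB d)) 3
  | all A hA => exact six (hA (d + 1)) 4
  | ex A hA => exact six (hA (d + 1)) 5

theorem primrec_encF_closure (A : Fml) : Primrec fun env => encF (closure A env) :=
  A.primrec_enc_close 0

theorem Trm.primrec_val (t : Trm) : Primrec fun env => t.val (listEnv env) := by
  induction t with
  | var i => exact (Primrec.list_getD 0).comp Primrec.id (Primrec.const i)
  | zero => exact Primrec.const 0
  | one => exact Primrec.const 1
  | add s t hs ht => exact Primrec.nat_add.comp hs ht
  | mul s t hs ht => exact Primrec.nat_mul.comp hs ht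

theorem primrec_trueLit (A : Fml) : Primrec (trueLit A) := by
  cases A with
  | eq s t => exact Primrec.eq.decide.comp s.primrec_val t.primrec_val
  | ne s t => exact Primrec.not.comp (Primrec.eq.decide.comp s.primrec_val t.primrec_val)
  | _ => exact Primrec.const false

theorem Fml.enc_injective : Function.Injective Fml.enc :=
  Encodable.encode_injective (α := Fml)

/-- Finitely many primitive recursive functions, indexed by formulas of bounded code, are
uniformly primitive recursive in the code. -/
theorem exists_primrec₂_of_bounded_enc {α σ : Type*} [Primcodable α] [Primcodable σ]
    [Inhabited σ] (g : Fml → α → σ) (hg : ∀ A, Primrec (g A)) (N : ℕ) :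
    ∃ G : ℕ → α → σ, Primrec₂ G ∧ ∀ A : Fml, A.enc ≤ N → ∀ a, G A.enc a = g A a := by
  suffices H : ∃ G : ℕ → α → σ, Primrec₂ G ∧ ∀ A : Fml, A.enc < N + 1 → ∀ a, G A.enc a = g A a by
    simpa only [Nat.lt_succ_iff] using H
  induction N + 1 with
  | zero => exact ⟨fun _ _ => default, Primrec.const default, by simp⟩
  | succ n ih =>
    obtain ⟨G, hG, hGg⟩ := ih
    by_cases h : ∃ A : Fml, A.enc = n
    · obtain ⟨A, rfl⟩ := h
      refine ⟨fun c a => if c = A.enc then g A a else G c a, ?_, fun B hB a => ?_⟩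
      · exact Primrec.ite (Primrec.eq.comp Primrec.fst (Primrec.const _))
          ((hg A).comp Primrec.snd) hG
      · by_cases hBA : B.enc = A.enc
        · simp [Fml.enc_injective hBA]
        · simp only [if_neg hBA]
          exact hGg B (by omega) a
    · exact ⟨G, hG, fun B hB a => hGg B
        ((Nat.lt_succ_iff.1 hB).lt_of_ne fun hn => h ⟨B, hn⟩) a⟩

theorem insert_eq_union_singleton (A : Sentence) (Γ : Finset Sentence) :
    insert A Γ = Γ ∪ {A} := by
  rw [Finset.union_comm, Finset.insert_eq]

theorem insert_insert_eq_union_pair (A B : Sentence) (Γ : Finset Sentence) :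
    insert B (insert A Γ) = Γ ∪ {A, B} := by
  ext C
  simp only [Finset.mem_insert, Finset.mem_union, Finset.mem_singleton]
  tauto

/-! ### The search tree -/

/-- An unprocessed formula of the search: a formula, the values of its free variables, and the
next witness to be tried if it is existential. -/
abbrev Item : Type := Fml × List ℕ × ℕ

/-- A node of the search tree: the current sequent, whether a true literal has been found, and
the queue of its unprocessed (non-literal) formulas. -/
structure SearchState : Type where
  sequent : Finset Sentence
  closed : Bool
  queue : List Item

namespace SearchState

/-- The state outside of the search tree. -/
def dead : SearchState := ⟨∅, false, []⟩

/-- Add a formula to the sequent, and to the queue unless it is a literal. -/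
def add (s : SearchState) (A : Fml) (env : List ℕ) : SearchState :=
  ⟨insert (closure A env) s.sequent, s.closed || trueLit A env,
    if A.isLiteral then s.queue else s.queue ++ [(A, env, 0)]⟩

/-- The `i`-th child of a node, obtained by reducing the first formula of the queue. -/
def child : SearchState → ℕ → SearchState
  | ⟨Γ, false, (.and A B, env, _) :: q⟩, i =>
    if i = 0 then add ⟨Γ, false, q⟩ A env
    else if i = 1 then add ⟨Γ, false, q⟩ B env
    else dead
  | ⟨Γ, false, (.or A B, env, _) :: q⟩, i =>
    if i = 0 then add (add ⟨Γ, false, q⟩ A env) B env else dead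
  | ⟨Γ, false, (.all A, env, _) :: q⟩, i => add ⟨Γ, false, q⟩ A (i :: env)
  | ⟨Γ, false, (.ex A, env, k) :: q⟩, i =>
    if i = 0 then add ⟨Γ, false, q ++ [(.ex A, env, k + 1)]⟩ A (k :: env) else dead
  | _, _ => dead

/-- The label of a node. -/
def label : SearchState → ℕ
  | ⟨Γ, true, _⟩ => tup [axC, encS Γ]
  | ⟨Γ, false, (.and A B, env, _) :: _⟩ => tup [andC, encS Γ, encF (closure (.and A B) env)]
  | ⟨Γ, false, (.or A B, env, _) :: _⟩ => tup [orC, encS Γ, encF (closure (.or A B) env)]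
  | ⟨Γ, false, (.all A, env, _) :: _⟩ => tup [omC, encS Γ, encF (closure (.all A) env)]
  | ⟨Γ, false, (.ex A, env, _) :: _⟩ => tup [exC, encS Γ, encF (closure (.ex A) env)]
  | _ => 0

/-- The node reached along a path. -/
def run (s : SearchState) (l : List ℕ) : SearchState := l.foldl child s

theorem label_dead : label dead = 0 := rfl

theorem child_dead (i : ℕ) : child dead i = dead := rfl

theorem run_dead (l : List ℕ) : run dead l = dead := by
  induction l with
  | nil => rfl
  | cons i l ih => exact ih

theorem run_cons (s : SearchState) (i : ℕ) (l : List ℕ) :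
    run s (i :: l) = run (child s i) l := rfl

theorem run_append (s : SearchState) (l l' : List ℕ) :
    run s (l ++ l') = run (run s l) l' := List.foldl_append

theorem run_concat (s : SearchState) (l : List ℕ) (i : ℕ) :
    run s (l ++ [i]) = child (run s l) i := run_append s l [i]

theorem child_eq_dead_of_label_eq_zero {s : SearchState} (h : label s = 0) (i : ℕ) :
    child s i = dead := by
  rcases s with ⟨Γ, _ | _, _ | ⟨⟨A, env, k⟩, q⟩⟩
  · rfl
  · cases A <;> first | rfl | exact absurd h (tup_ne_zero _)
  · rfl
  · rfl

theorem label_run_eq_zero {s : SearchState} (h : label s = 0) (l : List ℕ) :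
    label (run s l) = 0 := by
  cases l with
  | nil => exact h
  | cons i l => rw [run_cons, child_eq_dead_of_label_eq_zero h, run_dead, label_dead]

/-- The states generating a well founded search tree, all of whose nodes are correct. -/
inductive Good : SearchState → Prop
  | ax (Γ : Finset Sentence) (q : List Item) (h : IsAxiom Γ) : Good ⟨Γ, true, q⟩
  | and (Γ : Finset Sentence) (A B : Fml) (env : List ℕ) (k : ℕ) (q : List Item)
      (hΓ : closure (.and A B) env ∈ Γ) (hA : Good (add ⟨Γ, false, q⟩ A env))
      (hB : Good (add ⟨Γ, false, q⟩ B env)) : Good ⟨Γ, false, (.and A B, env, k) :: q⟩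
  | or (Γ : Finset Sentence) (A B : Fml) (env : List ℕ) (k : ℕ) (q : List Item)
      (hΓ : closure (.or A B) env ∈ Γ)
      (h : Good (add (add ⟨Γ, false, q⟩ A env) B env)) : Good ⟨Γ, false, (.or A B, env, k) :: q⟩
  | all (Γ : Finset Sentence) (A : Fml) (env : List ℕ) (k : ℕ) (q : List Item)
      (hΓ : closure (.all A) env ∈ Γ)
      (h : ∀ n, Good (add ⟨Γ, false, q⟩ A (n :: env))) : Good ⟨Γ, false, (.all A, env, k) :: q⟩
  | ex (Γ : Finset Sentence) (A : Fml) (env : List ℕ) (k : ℕ) (q : List Item)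
      (hΓ : closure (.ex A) env ∈ Γ)
      (h : Good (add ⟨Γ, false, q ++ [(.ex A, env, k + 1)]⟩ A (k :: env))) :
      Good ⟨Γ, false, (.ex A, env, k) :: q⟩

theorem Good.label_ne_zero {s : SearchState} (h : Good s) : label s ≠ 0 := by
  cases h <;> exact tup_ne_zero _

theorem Good.endS_label {s : SearchState} (h : Good s) : EndS (label s) = s.sequent := by
  cases h with
  | ax Γ q h => simp [label, EndS, proj_tup, decS_encS]
  | _ => simpa [label, EndS, proj_tup, axC, andC, orC, omC, exC, cutC, omrepC, decS_encS,
      decF_encF]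

theorem Good.child_good_or_eq_dead {s : SearchState} (h : Good s) (i : ℕ) :
    Good (child s i) ∨ child s i = dead := by
  cases h with
  | ax Γ q h => exact .inr rfl
  | and Γ A B env k q hΓ hA hB =>
    by_cases h₀ : i = 0
    · exact .inl (by simpa [child, h₀] using hA)
    · by_cases h₁ : i = 1
      · exact .inl (by simpa [child, h₁] using hB)
      · exact .inr (by simp [child, h₀, h₁])
  | or Γ A B env k q hΓ h =>
    by_cases h₀ : i = 0
    · exact .inl (by simpa [child, h₀] using h)
    · exact .inr (by simp [child, h₀])
  | all Γ A env k q hΓ h => exact .inl (h i)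
  | ex Γ A env k q hΓ h =>
    by_cases h₀ : i = 0
    · exact .inl (by simpa [child, h₀] using h)
    · exact .inr (by simp [child, h₀])

theorem Good.run_good_or_eq_dead {s : SearchState} (h : Good s) (l : List ℕ) :
    Good (run s l) ∨ run s l = dead := by
  induction l generalizing s with
  | nil => exact .inl h
  | cons i l ih =>
    rcases h.child_good_or_eq_dead i with h' | h'
    · exact ih h'
    · exact .inr (by rw [run_cons, h', run_dead])

theorem Good.run_good {s : SearchState} (h : Good s) {l : List ℕ} (hl : label (run s l) ≠ 0) :
    Good (run s l) :=
  (h.run_good_or_eq_dead l).resolve_right fun hd => hl (by rw [hd, label_dead])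

/-- Along every infinite path one leaves the tree below a good state. -/
theorem Good.exists_label_eq_zero {s : SearchState} (h : Good s) (f : ℕ → ℕ) :
    ∃ n, label (run s ((List.range n).map f)) = 0 := by
  have step (s : SearchState) (f : ℕ → ℕ)
      (h : ∃ n, label (run (child s (f 0)) ((List.range n).map (f ∘ Nat.succ))) = 0) :
      ∃ n, label (run s ((List.range n).map f)) = 0 := by
    obtain ⟨n, hn⟩ := h
    exact ⟨n + 1, by simpa [List.range_succ_eq_map, run_cons] using hn⟩
  have halts (s : SearchState) (f : ℕ → ℕ) (h : child s (f 0) = dead) :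
      ∃ n, label (run s ((List.range n).map f)) = 0 :=
    step s f ⟨0, by simp [h, run, label_dead]⟩
  induction h generalizing f with
  | ax Γ q h => exact halts _ _ rfl
  | and Γ A B env k q hΓ hA hB ihA ihB =>
    by_cases h₀ : f 0 = 0
    · exact step _ _ (by simpa [child, h₀] using ihA _)
    · by_cases h₁ : f 0 = 1
      · exact step _ _ (by simpa [child, h₁] using ihB _)
      · exact halts _ _ (by simp [child, h₀, h₁])
  | or Γ A B env k q hΓ h ih =>
    by_cases h₀ : f 0 = 0
    · exact step _ _ (by simpa [child, h₀] using ih _)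
    · exact halts _ _ (by simp [child, h₀])
  | all Γ A env k q hΓ h ih => exact step _ _ (ih _ _)
  | ex Γ A env k q hΓ h ih =>
    by_cases h₀ : f 0 = 0
    · exact step _ _ (by simpa [child, h₀] using ih _)
    · exact halts _ _ (by simp [child, h₀])

/-! ### True formulas are found -/

/-- The invariant of the search. -/
structure Inv (s : SearchState) : Prop where
  isAxiom : s.closed = true → IsAxiom s.sequent
  mem : ∀ A env k, (A, env, k) ∈ s.queue → closure A env ∈ s.sequent
  nonliteral : ∀ A env k, (A, env, k) ∈ s.queue → A.isLiteral = false

theorem Inv.add {s : SearchState} (hs : Inv s) (A : Fml) (env : List ℕ) : Inv (s.add A env) := by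
  refine ⟨fun h => ?_, fun B env' k h => ?_, fun B env' k h => ?_⟩
  · rcases Bool.or_eq_true_iff.1 h with h | h
    · obtain ⟨C, hC, hC'⟩ := hs.isAxiom h
      exact ⟨C, Finset.mem_insert_of_mem hC, hC'⟩
    · exact isAxiom_of_trueLit h (Finset.mem_insert_self _ _)
  · simp only [SearchState.add] at h ⊢
    split_ifs at h with hA
    · exact Finset.mem_insert_of_mem (hs.mem B env' k h)
    · rcases List.mem_append.1 h with h | h
      · exact Finset.mem_insert_of_mem (hs.mem B env' k h)
      · obtain ⟨rfl, rfl, rfl⟩ : B = A ∧ env' = env ∧ k = 0 := by simpa using h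
        exact Finset.mem_insert_self _ _
  · simp only [SearchState.add] at h
    split_ifs at h with hA
    · exact hs.nonliteral B env' k h
    · rcases List.mem_append.1 h with h | h
      · exact hs.nonliteral B env' k h
      · obtain ⟨rfl, rfl, rfl⟩ : B = A ∧ env' = env ∧ k = 0 := by simpa using h
        simpa using hA

theorem Inv.tail {Γ : Finset Sentence} {c : Bool} {it : Item} {q : List Item}
    (hs : Inv ⟨Γ, c, it :: q⟩) : Inv ⟨Γ, c, q⟩ :=
  ⟨hs.isAxiom, fun A env k h => hs.mem A env k (List.mem_cons_of_mem _ h),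
    fun A env k h => hs.nonliteral A env k (List.mem_cons_of_mem _ h)⟩

theorem Inv.requeue {Γ : Finset Sentence} {c : Bool} {A : Fml} {env : List ℕ} {k : ℕ}
    {q : List Item} (hs : Inv ⟨Γ, c, (A, env, k) :: q⟩) (k' : ℕ) :
    Inv ⟨Γ, c, q ++ [(A, env, k')]⟩ := by
  refine ⟨hs.isAxiom, fun B env' j h => ?_, fun B env' j h => ?_⟩
  · rcases List.mem_append.1 h with h | h
    · exact hs.mem B env' j (List.mem_cons_of_mem _ h)
    · obtain ⟨rfl, rfl, rfl⟩ : B = A ∧ env' = env ∧ j = k' := by simpa using h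
      exact hs.mem B env' k List.mem_cons_self
  · rcases List.mem_append.1 h with h | h
    · exact hs.nonliteral B env' j (List.mem_cons_of_mem _ h)
    · obtain ⟨rfl, rfl, rfl⟩ : B = A ∧ env' = env ∧ j = k' := by simpa using h
      exact hs.nonliteral B env' k List.mem_cons_self

theorem Inv.good_of_closed {s : SearchState} (hs : Inv s) (h : s.closed = true) : Good s := by
  obtain ⟨Γ, c, q⟩ := s
  obtain rfl : c = true := h
  exact .ax Γ q (hs.isAxiom rfl)

theorem queue_prefix_add (s : SearchState) (A : Fml) (env : List ℕ) :
    s.queue <+: (s.add A env).queue := by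
  simp only [add]
  split_ifs
  · exact List.prefix_rfl
  · exact List.prefix_append _ _

/-- If reaching an item at the head of the queue makes a state good, then so does its
occurrence anywhere in the queue. -/
theorem good_of_mem_queue {it : Item}
    (H : ∀ Γ q, Inv ⟨Γ, false, it :: q⟩ → Good ⟨Γ, false, it :: q⟩)
    {s : SearchState} (hs : Inv s) (hit : it ∈ s.queue) : Good s := by
  obtain ⟨n, hn⟩ := List.mem_iff_getElem?.1 hit
  clear hit
  induction n generalizing s with
  | zero =>
    rcases s with ⟨Γ, _ | _, _ | ⟨it', q⟩⟩
    · simp at hn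
    · obtain rfl : it' = it := by simpa using hn
      exact H Γ q hs
    · exact hs.good_of_closed rfl
    · exact hs.good_of_closed rfl
  | succ n ih =>
    have mono {s s' : SearchState} (h : s.queue <+: s'.queue) (hq : s.queue[n]? = some it) :
        s'.queue[n]? = some it := by
      obtain ⟨t, ht⟩ := h
      rw [← ht, List.getElem?_append_left (List.getElem?_eq_some_iff.1 hq).1, hq]
    rcases s with ⟨Γ, _ | _, _ | ⟨⟨A, env, k⟩, q⟩⟩
    · simp at hn
    · replace hn : q[n]? = some it := by simpa using hn
      have hΓ := hs.mem A env k List.mem_cons_self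
      have hl := hs.nonliteral A env k List.mem_cons_self
      have ht := hs.tail
      have hadd (B : Fml) (env' : List ℕ) : Good (add ⟨Γ, false, q⟩ B env') :=
        ih (ht.add B env') (mono (queue_prefix_add _ _ _) hn)
      cases A with
      | eq s t => simp [Fml.isLiteral] at hl
      | ne s t => simp [Fml.isLiteral] at hl
      | and A B => exact .and _ _ _ _ _ _ hΓ (hadd A env) (hadd B env)
      | or A B =>
        exact .or _ _ _ _ _ _ hΓ (ih ((ht.add A env).add B env)
          (mono (queue_prefix_add _ _ _) (mono (queue_prefix_add _ _ _) hn)))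
      | all A => exact .all _ _ _ _ _ hΓ fun i => hadd A (i :: env)
      | ex A =>
        refine .ex _ _ _ _ _ hΓ (ih ((hs.requeue (k + 1)).add A (k :: env))
          (mono (queue_prefix_add _ _ _) (mono (s := ⟨Γ, false, q⟩) ?_ hn)))
        exact List.prefix_append _ _
    · exact hs.good_of_closed rfl
    · exact hs.good_of_closed rfl

/-- The formula `A` under `env` is accounted for in `s`: it is a literal and the search has
been closed, or it is waiting in the queue. -/
def Has (s : SearchState) (A : Fml) (env : List ℕ) : Prop :=
  s.closed = true ∨ (A, env, 0) ∈ s.queue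

theorem has_add (s : SearchState) {A : Fml} {env : List ℕ} (h : A.Sat (listEnv env)) :
    Has (s.add A env) A env := by
  by_cases hA : A.isLiteral = true
  · exact .inl (by simp [add, (trueLit_iff hA env).2 h])
  · exact .inr (by simp [add, hA])

theorem Has.add {s : SearchState} {A : Fml} {env : List ℕ} (h : Has s A env) (B : Fml)
    (env' : List ℕ) : Has (s.add B env') A env :=
  h.imp (fun h => by simp [SearchState.add, h]) fun h => (queue_prefix_add s B env').subset h

/-- A state whose queue contains a true formula is good. -/
theorem good_of_sat (A : Fml) (env : List ℕ) (hA : A.Sat (listEnv env)) {s : SearchState}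
    (hs : Inv s) (h : Has s A env) : Good s := by
  induction A generalizing env s with
  | eq t u =>
    exact h.elim hs.good_of_closed fun h => by simpa [Fml.isLiteral] using hs.nonliteral _ _ _ h
  | ne t u =>
    exact h.elim hs.good_of_closed fun h => by simpa [Fml.isLiteral] using hs.nonliteral _ _ _ h
  | and A B ihA ihB =>
    refine h.elim hs.good_of_closed (good_of_mem_queue (fun Γ q hI => ?_) hs)
    exact .and _ _ _ _ _ _ (hI.mem _ _ _ List.mem_cons_self)
      (ihA env hA.1 (hI.tail.add _ _) (has_add _ hA.1))
      (ihB env hA.2 (hI.tail.add _ _) (has_add _ hA.2))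
  | or A B ihA ihB =>
    refine h.elim hs.good_of_closed (good_of_mem_queue (fun Γ q hI => ?_) hs)
    refine .or _ _ _ _ _ _ (hI.mem _ _ _ List.mem_cons_self) ?_
    have hI' := (hI.tail.add A env).add B env
    exact hA.elim (fun hA => ihA env hA hI' ((has_add _ hA).add _ _))
      fun hB => ihB env hB hI' (has_add _ hB)
  | all A ih =>
    refine h.elim hs.good_of_closed (good_of_mem_queue (fun Γ q hI => ?_) hs)
    refine .all _ _ _ _ _ (hI.mem _ _ _ List.mem_cons_self) fun n => ?_
    have hn : A.Sat (listEnv (n :: env)) := consEnv_listEnv n env ▸ hA n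
    exact ih _ hn (hI.tail.add _ _) (has_add _ hn)
  | ex A ih =>
    obtain ⟨n, hn⟩ := hA
    rw [consEnv_listEnv] at hn
    have key (d k : ℕ) (hk : k + d = n) {s : SearchState} (hs : Inv s)
        (h : (.ex A, env, k) ∈ s.queue) : Good s := by
      induction d generalizing k s with
      | zero =>
        obtain rfl : k = n := hk
        refine good_of_mem_queue (fun Γ q hI => ?_) hs h
        exact .ex _ _ _ _ _ (hI.mem _ _ _ List.mem_cons_self)
          (ih _ hn ((hI.requeue _).add _ _) (has_add _ hn))
      | succ d ihd =>
        refine good_of_mem_queue (fun Γ q hI => ?_) hs h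
        exact .ex _ _ _ _ _ (hI.mem _ _ _ List.mem_cons_self)
          (ihd (k + 1) (by omega) ((hI.requeue _).add _ _)
            ((queue_prefix_add _ _ _).subset (by simp)))
    exact h.elim hs.good_of_closed (key n 0 (by omega) hs)

/-- The root of the search tree of a sentence. -/
def init (A : Sentence) : SearchState := add dead A.1 []

theorem sequent_init (A : Sentence) : (init A).sequent = {A} := by
  simp [init, add, dead, closure, Fml.close_of_cu [] A.2]

theorem good_init {A : Sentence} (hA : sentTrue A) : Good (init A) :=
  good_of_sat A.1 [] hA (Inv.add ⟨by simp [dead], by simp [dead], by simp [dead]⟩ _ _)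
    (has_add _ hA)

/-! ### The search tree of a good state is an `ω`-proof -/

theorem treeOf_iff {s : SearchState} {π : ℕ → ℕ}
    (hπ : ∀ σ, π σ = if σ = 0 then 0 else label (run s (untup σ))) (σ : ℕ) :
    TreeOf π σ ↔ σ ≠ 0 ∧ label (run s (untup σ)) ≠ 0 := by
  rw [TreeOf, hπ]
  by_cases h : σ = 0 <;> simp [h]

theorem treeOf_snoc_iff {s : SearchState} {π : ℕ → ℕ}
    (hπ : ∀ σ, π σ = if σ = 0 then 0 else label (run s (untup σ))) (σ i : ℕ) :
    TreeOf π (snoc σ i) ↔ label (child (run s (untup σ)) i) ≠ 0 := by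
  rw [treeOf_iff hπ, snoc, untup_tup, run_concat]
  simp [tup_ne_zero]

theorem Good.correctInner {t : SearchState} {π : ℕ → ℕ} {σ : ℕ} (ht : Good t)
    (hσ : π σ = label t) (hsnoc : ∀ i, π (snoc σ i) = label (child t i))
    (htree : ∀ i, TreeOf π (snoc σ i) ↔ label (child t i) ≠ 0)
    (h0 : label (child t 0) ≠ 0) : CorrectInner π σ := by
  cases ht with
  | ax Γ q h => exact absurd label_dead h0
  | and Γ A B env k q hΓ hA hB =>
    refine .inl ⟨Γ, closure A env, closure B env, hσ, (htree 0).2 hA.label_ne_zero,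
      (htree 1).2 hB.label_ne_zero, fun h => (htree 2).1 h label_dead, ?_, ?_⟩
    · rw [hsnoc]
      exact hA.endS_label.trans (insert_eq_union_singleton _ _)
    · rw [hsnoc]
      exact hB.endS_label.trans (insert_eq_union_singleton _ _)
  | or Γ A B env k q hΓ h =>
    refine .inr (.inl ⟨Γ, closure A env, closure B env, hσ, (htree 0).2 h.label_ne_zero,
      fun h => (htree 1).1 h label_dead, ?_⟩)
    rw [hsnoc]
    exact h.endS_label.trans (insert_insert_eq_union_pair _ _ _)
  | all Γ A env k q hΓ h =>
    refine .inr (.inr (.inl ⟨Γ, A.close env 1, A.cu_close env 1, hσ,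
      fun n => (htree n).2 (h n).label_ne_zero, fun n => ?_⟩))
    rw [hsnoc, sInst_close]
    exact (h n).endS_label.trans (insert_eq_union_singleton _ _)
  | ex Γ A env k q hΓ h =>
    refine .inr (.inr (.inr (.inl ⟨Γ, A.close env 1, A.cu_close env 1, k, hσ,
      (htree 0).2 h.label_ne_zero, fun h => (htree 1).1 h label_dead, ?_⟩)))
    rw [hsnoc, sInst_close]
    exact h.endS_label.trans (insert_eq_union_singleton _ _)

theorem Good.isOmegaProof {s : SearchState} (hs : Good s) {π : ℕ → ℕ}
    (hπ : ∀ σ, π σ = if σ = 0 then 0 else label (run s (untup σ))) : IsOmegaProof π where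
  nonseq σ h := not_not.1 h
  downward σ τ hσ hτ hpre := by
    rw [treeOf_iff hπ] at hσ ⊢
    refine ⟨hτ, fun h => hσ.2 ?_⟩
    obtain ⟨l, hl⟩ := hpre
    rw [← hl, run_append]
    exact label_run_eq_zero h l
  mono σ i j hij h := by
    rw [treeOf_snoc_iff hπ] at h ⊢
    rcases hs.run_good_or_eq_dead (untup σ) with hg | hd
    · generalize run s (untup σ) = t at hg h
      cases hg with
      | ax Γ q h' => exact absurd label_dead h
      | and Γ A B env k q hΓ hA hB =>
        obtain rfl : i = 0 := by
          by_contra hi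
          exact h (by simp [child, show j ≠ 0 by omega, show j ≠ 1 by omega, label_dead])
        exact hA.label_ne_zero
      | or Γ A B env k q hΓ h' =>
        exact absurd (by simp [child, show j ≠ 0 by omega, label_dead]) h
      | all Γ A env k q hΓ h' => exact (h' i).label_ne_zero
      | ex Γ A env k q hΓ h' =>
        exact absurd (by simp [child, show j ≠ 0 by omega, label_dead]) h
    · rw [hd, child_dead, label_dead] at h
      exact absurd rfl h
  top σ h h0 := by
    rw [treeOf_snoc_iff hπ, not_not] at h0
    rw [treeOf_iff hπ] at h
    rw [hπ, if_neg h.1]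
    have hg := hs.run_good h.2
    generalize run s (untup σ) = t at hg h0
    cases hg with
    | ax Γ q h' => exact ⟨Γ, h', rfl⟩
    | and Γ A B env k q hΓ hA hB => exact absurd h0 hA.label_ne_zero
    | or Γ A B env k q hΓ h' => exact absurd h0 h'.label_ne_zero
    | all Γ A env k q hΓ h' => exact absurd h0 (h' 0).label_ne_zero
    | ex Γ A env k q hΓ h' => exact absurd h0 h'.label_ne_zero
  inner σ h h0 := by
    rw [treeOf_snoc_iff hπ] at h0
    have h' := (treeOf_iff hπ σ).1 h
    refine (hs.run_good h'.2).correctInner (by rw [hπ, if_neg h'.1]) (fun i => ?_)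
      (treeOf_snoc_iff hπ σ) h0
    rw [hπ, snoc, if_neg (tup_ne_zero _), untup_tup, run_concat]
  wf := by
    rintro ⟨f, hf⟩
    obtain ⟨n, hn⟩ := hs.exists_label_eq_zero f
    refine ((treeOf_iff hπ _).1 (hf n)).2 ?_
    rw [untup_tup, hn]

theorem Good.cutFree {s : SearchState} (hs : Good s) {π : ℕ → ℕ}
    (hπ : ∀ σ, π σ = if σ = 0 then 0 else label (run s (untup σ))) : CutFree π := by
  intro σ h
  rw [treeOf_iff hπ] at h
  rw [hπ, if_neg h.1]
  have hg := hs.run_good h.2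
  generalize run s (untup σ) = t at hg
  cases hg <;> simp [label, proj_tup, axC, andC, orC, omC, exC, cutC]

end SearchState

/-! ### Recursive evaluation of finitely branching trees with indices at infinite nodes -/

open Nat.Partrec (Code) in
/-- By the recursion theorem there is a recursive function `v` with indices `idx s` of
`n ↦ v (child s n)`, which is `leaf s (idx s)` at the states where `halts` holds and is computed
from the values at two children at all other states. -/
theorem exists_recursive_tree_code {S : Type*} [Primcodable S] [Inhabited S]
    {child : S → ℕ → S} (hchild : Primrec₂ child) {halts : S → Bool} (hhalts : Primrec halts)
    {leaf : S → ℕ → ℕ} (hleaf : Primrec₂ leaf) {second : S → ℕ} (hsecond : Primrec second)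
    {comb : S → ℕ × ℕ → ℕ} (hcomb : Primrec₂ comb) :
    ∃ (v : S → Part ℕ) (idx : S → ℕ), (∀ s n, peval (idx s) n = v (child s n)) ∧
      ∀ s, v s = bif halts s then Part.some (leaf s (idx s)) else
        (v (child s 0)).bind fun a => (v (child s (second s))).bind fun b =>
          Part.some (comb s (a, b)) := by
  let dec : ℕ → S := fun n => (Encodable.decode (α := S) n).getD default
  have hdec : Primrec dec := Primrec.option_getD.comp Primrec.decode (Primrec.const _)
  have dec_encode (s : S) : dec (Encodable.encode s) = s := by simp [dec]
  have hstep : Primrec fun p : ℕ => Encodable.encode (child (dec p.unpair.1) p.unpair.2) :=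
    Primrec.encode.comp (hchild.comp (hdec.comp (Primrec.fst.comp Primrec.unpair))
      (Primrec.snd.comp Primrec.unpair))
  obtain ⟨d, hd⟩ := Code.exists_code.1 (Nat.Partrec.of_primrec (Primrec.nat_iff.1 hstep))
  let idx : Code → ℕ → ℕ := fun c n => Encodable.encode (Code.curry (Code.comp c d) n)
  have hidx : Primrec₂ idx :=
    Primrec.encode.comp (Code.primrec₂_curry.comp
      (Code.primrec₂_comp.comp Primrec.fst (Primrec.const d)) Primrec.snd)
  have hevalchild {α : Type} [Primcodable α] {c : α → Code} {n : α → ℕ} {i : α → ℕ}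
      (hc : Primrec c) (hn : Primrec n) (hi : Primrec i) :
      Partrec fun p : α => (c p).eval (Encodable.encode (child (dec (n p)) (i p))) :=
    Code.eval_part.comp hc.to_comp
      (Primrec.encode.comp (hchild.comp (hdec.comp hn) hi)).to_comp
  let F : Code → ℕ →. ℕ := fun c n =>
    bif halts (dec n) then Part.some (leaf (dec n) (idx c n)) else
      (c.eval (Encodable.encode (child (dec n) 0))).bind fun a =>
        (c.eval (Encodable.encode (child (dec n) (second (dec n))))).bind fun b =>
          Part.some (comb (dec n) (a, b))
  have hF : Partrec₂ F := by
    refine Partrec.cond (hhalts.comp (hdec.comp Primrec.snd)).to_comp ?_ ?_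
    · exact (hleaf.comp (hdec.comp Primrec.snd) hidx).to_comp
    · refine Partrec.bind (hevalchild Primrec.fst Primrec.snd (Primrec.const 0)) ?_
      refine Partrec.bind (hevalchild (Primrec.fst.comp Primrec.fst)
        (Primrec.snd.comp Primrec.fst)
        (hsecond.comp (hdec.comp (Primrec.snd.comp Primrec.fst)))) ?_
      exact (hcomb.comp (hdec.comp (Primrec.snd.comp (Primrec.fst.comp Primrec.fst)))
        (Primrec.pair (Primrec.snd.comp Primrec.fst) Primrec.snd)).to_comp
  obtain ⟨c, hc⟩ := Code.fixed_point₂ hF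
  refine ⟨fun s => c.eval (Encodable.encode s), fun s => idx c (Encodable.encode s),
    fun s n => ?_, fun s => ?_⟩
  · simp [idx, peval, Code.eval_curry, Code.eval, hd, dec_encode]
    exact Part.bind_some _ _
  · conv_lhs => rw [hc]
    simp only [F, dec_encode]

/-! ### The coded search tree -/

/-- Codes of search states: the sorted list of codes of the sequent, the flag, and the queue
with formulas replaced by their codes. -/
abbrev CodedState : Type := List ℕ × Bool × List (ℕ × List ℕ × ℕ)

namespace CodedState

/-- The first item of the queue. -/
def head (s : CodedState) : ℕ × List ℕ × ℕ := s.2.2.headI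

/-- The code of the state outside of the search tree. -/
def dead : CodedState := ([], false, [])

/-- The coded version of `SearchState.add`, where `E` computes codes of instances and `T` truth
values of literals. -/
def add (E : ℕ → List ℕ → ℕ) (T : ℕ → List ℕ → Bool) (s : CodedState) (it : ℕ × List ℕ) :
    CodedState :=
  (insertCode (E it.1 it.2) s.1, s.2.1 || T it.1 it.2,
    if it.1 % 6 < 2 then s.2.2 else s.2.2 ++ [(it.1, it.2, 0)])

/-- Remove the first item of the queue. -/
def pop (s : CodedState) : CodedState := (s.1, s.2.1, s.2.2.tail)

/-- Move the first item to the end of the queue, incrementing its counter. -/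
def requeue (s : CodedState) : CodedState :=
  (s.1, s.2.1, s.2.2.tail ++ [(s.head.1, s.head.2.1, s.head.2.2 + 1)])

/-- The coded version of `SearchState.child`. -/
def child (E : ℕ → List ℕ → ℕ) (T : ℕ → List ℕ → Bool) (s : CodedState) (i : ℕ) : CodedState :=
  if s.2.1 = true then dead
  else if s.head.1 % 6 = 2 then
    if i = 0 then add E T s.pop ((s.head.1 / 6).unpair.1, s.head.2.1)
    else if i = 1 then add E T s.pop ((s.head.1 / 6).unpair.2, s.head.2.1)
    else dead
  else if s.head.1 % 6 = 3 then
    if i = 0 then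
      add E T (add E T s.pop ((s.head.1 / 6).unpair.1, s.head.2.1))
        ((s.head.1 / 6).unpair.2, s.head.2.1)
    else dead
  else if s.head.1 % 6 = 4 then add E T s.pop (s.head.1 / 6, i :: s.head.2.1)
  else if s.head.1 % 6 = 5 then
    if i = 0 then add E T s.requeue (s.head.1 / 6, s.head.2.2 :: s.head.2.1) else dead
  else dead

/-- The first two or three entries of the label of a coded state. -/
def labelList (E : ℕ → List ℕ → ℕ) (s : CodedState) : List ℕ :=
  if s.2.1 = true then [1, Encodable.encode s.1]
  else [s.head.1 % 6, Encodable.encode s.1, E s.head.1 s.head.2.1]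

/-- The coded version of `SearchState.label`. -/
def label (E : ℕ → List ℕ → ℕ) (s : CodedState) : ℕ :=
  if s.2.1 = false ∧ s.head.1 % 6 < 2 then 0 else tup (s.labelList E)

variable {E : ℕ → List ℕ → ℕ} {T : ℕ → List ℕ → Bool}

theorem primrec_head : Primrec head := Primrec.list_headI.comp (Primrec.snd.comp Primrec.snd)

theorem primrec_add (hE : Primrec₂ E) (hT : Primrec₂ T) : Primrec₂ (add E T) := by
  have h₁ : Primrec fun p : CodedState × ℕ × List ℕ => p.2.1 := Primrec.fst.comp Primrec.snd
  have h₂ : Primrec fun p : CodedState × ℕ × List ℕ => p.2.2 := Primrec.snd.comp Primrec.snd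
  have hq : Primrec fun p : CodedState × ℕ × List ℕ => p.1.2.2 :=
    Primrec.snd.comp (Primrec.snd.comp Primrec.fst)
  refine Primrec.pair (primrec_insertCode.comp (hE.comp h₁ h₂) (Primrec.fst.comp Primrec.fst))
    (Primrec.pair (Primrec.or.comp (Primrec.fst.comp (Primrec.snd.comp Primrec.fst))
      (hT.comp h₁ h₂)) (Primrec.ite ?_ hq ?_))
  · exact Primrec.nat_lt.comp (Primrec.nat_mod.comp h₁ (Primrec.const 6)) (Primrec.const 2)
  · exact Primrec.list_concat.comp hq (Primrec.pair h₁ (Primrec.pair h₂ (Primrec.const 0)))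

theorem primrec_pop : Primrec pop :=
  Primrec.pair Primrec.fst (Primrec.pair (Primrec.fst.comp Primrec.snd)
    (Primrec.list_tail.comp (Primrec.snd.comp Primrec.snd)))

theorem primrec_requeue : Primrec requeue :=
  Primrec.pair Primrec.fst (Primrec.pair (Primrec.fst.comp Primrec.snd)
    (Primrec.list_concat.comp (Primrec.list_tail.comp (Primrec.snd.comp Primrec.snd))
      (Primrec.pair (Primrec.fst.comp primrec_head)
        (Primrec.pair (Primrec.fst.comp (Primrec.snd.comp primrec_head))
          (Primrec.succ.comp (Primrec.snd.comp (Primrec.snd.comp primrec_head)))))))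

theorem primrec_tag : Primrec fun s : CodedState => s.head.1 % 6 :=
  Primrec.nat_mod.comp (Primrec.fst.comp primrec_head) (Primrec.const 6)

theorem primrec_child (hE : Primrec₂ E) (hT : Primrec₂ T) : Primrec₂ (child E T) := by
  have hadd := primrec_add hE hT
  have hh : Primrec fun p : CodedState × ℕ => p.1.head := primrec_head.comp Primrec.fst
  have henv : Primrec fun p : CodedState × ℕ => p.1.head.2.1 :=
    Primrec.fst.comp (Primrec.snd.comp hh)
  have hk : Primrec fun p : CodedState × ℕ => p.1.head.2.2 :=
    Primrec.snd.comp (Primrec.snd.comp hh)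
  have hbody : Primrec fun p : CodedState × ℕ => p.1.head.1 / 6 :=
    Primrec.nat_div.comp (Primrec.fst.comp hh) (Primrec.const 6)
  have hl : Primrec fun p : CodedState × ℕ => (p.1.head.1 / 6).unpair.1 :=
    Primrec.fst.comp (Primrec.unpair.comp hbody)
  have hr : Primrec fun p : CodedState × ℕ => (p.1.head.1 / 6).unpair.2 :=
    Primrec.snd.comp (Primrec.unpair.comp hbody)
  have hpop : Primrec fun p : CodedState × ℕ => p.1.pop := primrec_pop.comp Primrec.fst
  have htag (m : ℕ) : PrimrecPred fun p : CodedState × ℕ => p.1.head.1 % 6 = m :=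
    Primrec.eq.comp (primrec_tag.comp Primrec.fst) (Primrec.const m)
  have hi (m : ℕ) : PrimrecPred fun p : CodedState × ℕ => p.2 = m :=
    Primrec.eq.comp Primrec.snd (Primrec.const m)
  have hdead : Primrec fun _ : CodedState × ℕ => dead := Primrec.const _
  have haddl := hadd.comp hpop (Primrec.pair hl henv)
  refine Primrec.ite (Primrec.eq.comp (Primrec.fst.comp (Primrec.snd.comp Primrec.fst))
    (Primrec.const true)) hdead ?_
  refine Primrec.ite (htag 2) ?_ (Primrec.ite (htag 3) ?_ (Primrec.ite (htag 4) ?_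
    (Primrec.ite (htag 5) ?_ hdead)))
  · exact Primrec.ite (hi 0) haddl
      (Primrec.ite (hi 1) (hadd.comp hpop (Primrec.pair hr henv)) hdead)
  · exact Primrec.ite (hi 0) (hadd.comp haddl (Primrec.pair hr henv)) hdead
  · exact hadd.comp hpop (Primrec.pair hbody (Primrec.list_cons.comp Primrec.snd henv))
  · exact Primrec.ite (hi 0) (hadd.comp (primrec_requeue.comp Primrec.fst)
      (Primrec.pair hbody (Primrec.list_cons.comp hk henv))) hdead

theorem primrec_labelList (hE : Primrec₂ E) : Primrec (labelList E) := by
  have hg : Primrec fun s : CodedState => Encodable.encode s.1 :=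
    Primrec.encode.comp Primrec.fst
  have hF : Primrec fun s : CodedState => E s.head.1 s.head.2.1 :=
    hE.comp (Primrec.fst.comp primrec_head) (Primrec.fst.comp (Primrec.snd.comp primrec_head))
  have hnil : Primrec fun _ : CodedState => ([] : List ℕ) := Primrec.const _
  exact Primrec.ite (Primrec.eq.comp (Primrec.fst.comp Primrec.snd) (Primrec.const true))
    (Primrec.list_cons.comp (Primrec.const 1) (Primrec.list_cons.comp hg hnil))
    (Primrec.list_cons.comp primrec_tag (Primrec.list_cons.comp hg
      (Primrec.list_cons.comp hF hnil)))

theorem primrec_label (hE : Primrec₂ E) : Primrec (label E) := by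
  refine Primrec.ite (PrimrecPred.and ?_ ?_) (Primrec.const 0)
    (primrec_tup.comp (primrec_labelList hE))
  · exact Primrec.eq.comp (Primrec.fst.comp Primrec.snd) (Primrec.const false)
  · exact Primrec.nat_lt.comp primrec_tag (Primrec.const 2)

end CodedState

/-! ### The coded search tree agrees with the search tree -/

theorem Fml.isLiteral_iff_enc (A : Fml) : A.isLiteral = true ↔ A.enc % 6 < 2 := by
  cases A <;> simp [Fml.isLiteral, Fml.enc]

namespace SearchState

/-- All formulas in the queue have codes at most `N`. -/
def Bounded (N : ℕ) (s : SearchState) : Prop := ∀ it ∈ s.queue, it.1.enc ≤ N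

/-- The code of a search state. -/
def coded (s : SearchState) : CodedState :=
  (codeList s.sequent, s.closed, s.queue.map fun it => (it.1.enc, it.2))

theorem coded_dead : coded dead = CodedState.dead := by
  simp [coded, dead, CodedState.dead, codeList]

theorem Bounded.add {N : ℕ} {s : SearchState} (hs : Bounded N s) {A : Fml} (hA : A.enc ≤ N)
    (env : List ℕ) : Bounded N (s.add A env) := by
  intro it hit
  simp only [SearchState.add] at hit
  split_ifs at hit with h
  · exact hs it hit
  · rcases List.mem_append.1 hit with h | h
    · exact hs it h
    · obtain rfl : it = (A, env, 0) := by simpa using h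
      exact hA

theorem Bounded.tail {N : ℕ} {Γ : Finset Sentence} {c : Bool} {it : Item} {q : List Item}
    (hs : Bounded N ⟨Γ, c, it :: q⟩) : Bounded N ⟨Γ, c, q⟩ :=
  fun it' h => hs it' (List.mem_cons_of_mem _ h)

theorem Bounded.requeue {N : ℕ} {Γ : Finset Sentence} {c : Bool} {A : Fml} {env : List ℕ} {k : ℕ}
    {q : List Item} (hs : Bounded N ⟨Γ, c, (A, env, k) :: q⟩) (k' : ℕ) :
    Bounded N ⟨Γ, c, q ++ [(A, env, k')]⟩ := by
  intro it hit
  rcases List.mem_append.1 hit with h | h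
  · exact hs it (List.mem_cons_of_mem _ h)
  · obtain rfl : it = (A, env, k') := by simpa using h
    exact hs (A, env, k) List.mem_cons_self

theorem bounded_dead (N : ℕ) : Bounded N dead := fun it h => by simp [dead] at h

theorem Bounded.and {N : ℕ} {A B : Fml} (h : (Fml.and A B).enc ≤ N) : A.enc ≤ N ∧ B.enc ≤ N := by
  have h₁ := Nat.left_le_pair A.enc B.enc
  have h₂ := Nat.right_le_pair A.enc B.enc
  simp only [Fml.enc] at h
  omega

theorem Bounded.or {N : ℕ} {A B : Fml} (h : (Fml.or A B).enc ≤ N) : A.enc ≤ N ∧ B.enc ≤ N := by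
  have h₁ := Nat.left_le_pair A.enc B.enc
  have h₂ := Nat.right_le_pair A.enc B.enc
  simp only [Fml.enc] at h
  omega

theorem Bounded.all {N : ℕ} {A : Fml} (h : (Fml.all A).enc ≤ N) : A.enc ≤ N := by
  simp only [Fml.enc] at h
  omega

theorem Bounded.ex {N : ℕ} {A : Fml} (h : (Fml.ex A).enc ≤ N) : A.enc ≤ N := by
  simp only [Fml.enc] at h
  omega

theorem Bounded.child {N : ℕ} {s : SearchState} (hs : Bounded N s) (i : ℕ) :
    Bounded N (s.child i) := by
  rcases s with ⟨Γ, _ | _, _ | ⟨⟨A, env, k⟩, q⟩⟩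
  · exact bounded_dead N
  · have hA : A.enc ≤ N := hs _ List.mem_cons_self
    cases A with
    | eq s t => exact bounded_dead N
    | ne s t => exact bounded_dead N
    | and A B =>
      simp only [SearchState.child]
      split_ifs
      · exact hs.tail.add (Bounded.and hA).1 _
      · exact hs.tail.add (Bounded.and hA).2 _
      · exact bounded_dead N
    | or A B =>
      simp only [SearchState.child]
      split_ifs
      · exact (hs.tail.add (Bounded.or hA).1 _).add (Bounded.or hA).2 _
      · exact bounded_dead N
    | all A => exact hs.tail.add (Bounded.all hA) _
    | ex A =>
      simp only [SearchState.child]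
      split_ifs
      · exact (hs.requeue _).add (Bounded.ex hA) _
      · exact bounded_dead N
  · exact bounded_dead N
  · exact bounded_dead N

/-- `E` and `T` compute the codes and truth values of instances of formulas with codes at most
`N`. -/
structure Computes (N : ℕ) (E : ℕ → List ℕ → ℕ) (T : ℕ → List ℕ → Bool) : Prop where
  code : ∀ A : Fml, A.enc ≤ N → ∀ env, E A.enc env = encF (closure A env)
  truth : ∀ A : Fml, A.enc ≤ N → ∀ env, T A.enc env = trueLit A env

variable {N : ℕ} {E : ℕ → List ℕ → ℕ} {T : ℕ → List ℕ → Bool}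

theorem coded_add (hET : Computes N E T) (s : SearchState) {A : Fml} (hA : A.enc ≤ N)
    (env : List ℕ) : coded (s.add A env) = CodedState.add E T s.coded (A.enc, env) := by
  simp only [coded, add, CodedState.add, codeList_insert, hET.code A hA, hET.truth A hA,
    A.isLiteral_iff_enc]
  split_ifs <;> simp

theorem coded_child (hET : Computes N E T) {s : SearchState} (hs : Bounded N s) (i : ℕ) :
    coded (s.child i) = CodedState.child E T s.coded i := by
  rcases s with ⟨Γ, _ | _, _ | ⟨⟨A, env, k⟩, q⟩⟩
  · exact coded_dead
  · have hA : A.enc ≤ N := hs _ List.mem_cons_self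
    have hdiv (m : ℕ) : (6 * m + 2) / 6 = m ∧ (6 * m + 3) / 6 = m ∧ (6 * m + 4) / 6 = m ∧
        (6 * m + 5) / 6 = m := by omega
    have hpop : CodedState.pop (coded ⟨Γ, false, (A, env, k) :: q⟩) = coded ⟨Γ, false, q⟩ := rfl
    cases A with
    | eq s t => exact coded_dead.trans (by simp [CodedState.child, CodedState.head, coded, Fml.enc])
    | ne s t =>
      exact coded_dead.trans
        (by simp [CodedState.child, CodedState.head, coded, Fml.enc])
    | and A B =>
      have h := Bounded.and hA
      have hhead : CodedState.head (coded ⟨Γ, false, (.and A B, env, k) :: q⟩) =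
        (6 * Nat.pair A.enc B.enc + 2, env, k) := rfl
      have hcl : (coded ⟨Γ, false, (.and A B, env, k) :: q⟩).2.1 = false := rfl
      simp only [child, CodedState.child, hhead, hpop, hcl, hdiv, Nat.unpair_pair,
        apply_ite coded, coded_add hET _ h.1, coded_add hET _ h.2, coded_dead]
      simp
    | or A B =>
      have h := Bounded.or hA
      have hhead : CodedState.head (coded ⟨Γ, false, (.or A B, env, k) :: q⟩) =
        (6 * Nat.pair A.enc B.enc + 3, env, k) := rfl
      have hcl : (coded ⟨Γ, false, (.or A B, env, k) :: q⟩).2.1 = false := rfl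
      simp only [child, CodedState.child, hhead, hpop, hcl, hdiv, Nat.unpair_pair,
        apply_ite coded, coded_add hET _ h.1, coded_add hET _ h.2, coded_dead]
      simp
    | all A =>
      have hhead : CodedState.head (coded ⟨Γ, false, (.all A, env, k) :: q⟩) =
        (6 * A.enc + 4, env, k) := rfl
      have hcl : (coded ⟨Γ, false, (.all A, env, k) :: q⟩).2.1 = false := rfl
      simp only [child, CodedState.child, hhead, hpop, hcl, hdiv,
        coded_add hET _ (Bounded.all hA)]
      simp
    | ex A =>
      have hhead : CodedState.head (coded ⟨Γ, false, (.ex A, env, k) :: q⟩) =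
        (6 * A.enc + 5, env, k) := rfl
      have hcl : (coded ⟨Γ, false, (.ex A, env, k) :: q⟩).2.1 = false := rfl
      have hre : CodedState.requeue (coded ⟨Γ, false, (.ex A, env, k) :: q⟩) =
          coded ⟨Γ, false, q ++ [(.ex A, env, k + 1)]⟩ := by
        simp [CodedState.requeue, CodedState.head, coded]
      simp only [child, CodedState.child, hhead, hre, hcl, hdiv,
        apply_ite coded, coded_add hET _ (Bounded.ex hA), coded_dead]
      simp
  · exact coded_dead
  · exact coded_dead

theorem coded_run (hET : Computes N E T) {s : SearchState} (hs : Bounded N s) (l : List ℕ) :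
    coded (s.run l) = l.foldl (CodedState.child E T) s.coded := by
  induction l generalizing s with
  | nil => rfl
  | cons i l ih => rw [run_cons, ih (hs.child i), coded_child hET hs, List.foldl_cons]

theorem Bounded.run {s : SearchState} (hs : Bounded N s) (l : List ℕ) : Bounded N (s.run l) := by
  induction l generalizing s with
  | nil => exact hs
  | cons i l ih => exact ih (hs.child i)

theorem label_coded (hET : Computes N E T) {s : SearchState} (hs : Bounded N s) :
    CodedState.label E s.coded = label s := by
  rcases s with ⟨Γ, _ | _, _ | ⟨⟨A, env, k⟩, q⟩⟩
  · rfl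
  · have hA := hET.code A (hs _ List.mem_cons_self) env
    have hmod (m r : ℕ) (hr : r < 6) : (6 * m + r) % 6 = r := by omega
    cases A <;> simp [CodedState.label, CodedState.labelList, CodedState.head, coded, label, hA,
      ← encS_eq_encode_codeList] <;> simp [Fml.enc, hmod, andC, orC, omC, exC]
  · simp [CodedState.label, CodedState.labelList, coded, label, axC, encS_eq_encode_codeList]
  · simp [CodedState.label, CodedState.labelList, coded, label, axC, encS_eq_encode_codeList]

theorem primrec_of_eq_label_run (hE : Primrec₂ E) (hT : Primrec₂ T) (hET : Computes N E T)
    {s : SearchState} (hs : Bounded N s) {π : ℕ → ℕ}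
    (hπ : ∀ σ, π σ = if σ = 0 then 0 else label (run s (untup σ))) : Nat.Primrec π := by
  have hfold : Primrec fun σ : ℕ => (untup σ).foldl (CodedState.child E T) s.coded :=
    Primrec.list_foldl primrec_untup (Primrec.const _)
      ((CodedState.primrec_child hE hT).comp₂ (Primrec.fst.comp Primrec.snd).to₂
        (Primrec.snd.comp Primrec.snd).to₂)
  refine Primrec.nat_iff.1 (Primrec.of_eq (Primrec.ite
    (Primrec.eq.comp Primrec.id (Primrec.const 0)) (Primrec.const 0)
    ((CodedState.primrec_label hE).comp hfold)) fun σ => ?_)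
  rw [hπ, ← coded_run hET hs, label_coded hET (hs.run _)]
  rfl

/-! ### The local code of a good state -/

theorem nodeVal_walkCode_zero (l : List ℕ) : nodeVal (walkCode 0 l) = 0 := by
  induction l with
  | nil => simp [walkCode, nodeVal, proj_zero, axC, andC, orC, omC, exC, cutC]
  | cons i l ih =>
    have h : childCode 0 i = 0 := by
      simp [childCode, proj_zero, andC, orC, omC, exC, cutC]
    rw [walkCode, h, ih]

/-- The number `a` is a cut free local code of the search tree below `s`. -/
structure IsLocalCode (a : ℕ) (s : SearchState) : Prop where
  crec : CrecM a
  endS : EndS a = s.sequent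
  node : ∀ l, nodeVal (walkCode a l) = label (run s l)

theorem isLocalCode_of_children {a : ℕ} {s : SearchState} (hs : Good s) (hcrec : CrecM a)
    (hnode : nodeVal a = label s) (hend : EndS a = EndS (label s))
    (hchild : ∀ i, IsLocalCode (childCode a i) (child s i) ∨
      childCode a i = 0 ∧ child s i = dead) : IsLocalCode a s := by
  refine ⟨hcrec, hend.trans hs.endS_label, fun l => ?_⟩
  cases l with
  | nil => exact hnode
  | cons i l =>
    rw [walkCode, run_cons]
    rcases hchild i with h | ⟨h, h'⟩
    · exact h.node l
    · rw [h, h', run_dead, label_dead, nodeVal_walkCode_zero]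

/-- Local codes of all good states of bounded queue, by the recursion theorem. -/
theorem exists_isLocalCode (hE : Primrec₂ E) (hT : Primrec₂ T) (hET : Computes N E T)
    {s : SearchState} (hs : Good s) (hN : Bounded N s) : ∃ a, IsLocalCode a s := by
  have hL := CodedState.primrec_labelList hE
  have htag (m : ℕ) : PrimrecPred fun s : CodedState => s.head.1 % 6 = m :=
    Primrec.eq.comp CodedState.primrec_tag (Primrec.const m)
  have hnil {α : Type} [Primcodable α] : Primrec fun _ : α => ([] : List ℕ) := Primrec.const _
  have hhalts : Primrec fun s : CodedState => s.2.1 || decide (s.head.1 % 6 = 4) :=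
    Primrec.or.comp (Primrec.fst.comp Primrec.snd) (htag 4).decide
  have hleaf : Primrec₂ fun (s : CodedState) (e : ℕ) =>
      tup (s.labelList E ++ if s.2.1 = true then [] else [e]) :=
    primrec_tup.comp (Primrec.list_append.comp (hL.comp Primrec.fst)
      (Primrec.ite (Primrec.eq.comp (Primrec.fst.comp (Primrec.snd.comp Primrec.fst))
        (Primrec.const true)) hnil (Primrec.list_cons.comp Primrec.snd hnil)))
  have hsecond : Primrec fun s : CodedState => if s.head.1 % 6 = 2 then 1 else 0 :=
    Primrec.ite (htag 2) (Primrec.const 1) (Primrec.const 0)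
  have hcomb : Primrec₂ fun (s : CodedState) (p : ℕ × ℕ) =>
      tup (s.labelList E ++ if s.head.1 % 6 = 2 then [p.1, p.2] else [p.1]) := by
    have h₁ : Primrec fun p : CodedState × ℕ × ℕ => p.2.1 := Primrec.fst.comp Primrec.snd
    have h₂ : Primrec fun p : CodedState × ℕ × ℕ => p.2.2 := Primrec.snd.comp Primrec.snd
    exact primrec_tup.comp (Primrec.list_append.comp (hL.comp Primrec.fst)
      (Primrec.ite ((htag 2).comp Primrec.fst)
        (Primrec.list_cons.comp h₁ (Primrec.list_cons.comp h₂ hnil))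
        (Primrec.list_cons.comp h₁ hnil)))
  obtain ⟨v, idx, hidx, hv⟩ := exists_recursive_tree_code (CodedState.primrec_child hE hT) hhalts
    hleaf hsecond hcomb
  suffices H : ∃ a, a ∈ v s.coded ∧ IsLocalCode a s from H.imp fun _ h => h.2
  have hmod (m r : ℕ) (hr : r < 6) : (6 * m + r) % 6 = r := by omega
  induction hs with
  | ax Γ q h =>
    refine ⟨tup [axC, encS Γ], ?_, isLocalCode_of_children (.ax Γ q h) (.ax Γ h) ?_ rfl
      fun i => .inr ⟨?_, rfl⟩⟩
    · rw [hv]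
      simp [coded, CodedState.labelList, axC, encS_eq_encode_codeList]
    · simp [nodeVal, proj_tup, label]
    · simp [childCode, proj_tup, axC, andC, orC, omC, exC, cutC]
  | and Γ A B env k q hΓ hA hB ihA ihB =>
    have hAB : (Fml.and A B).enc ≤ N := hN _ List.mem_cons_self
    obtain ⟨a, hav, ha⟩ := ihA (hN.tail.add (Bounded.and hAB).1 env)
    obtain ⟨b, hbv, hb⟩ := ihB (hN.tail.add (Bounded.and hAB).2 env)
    refine ⟨tup [andC, encS Γ, encF (closure (.and A B) env), a, b], ?_,
      isLocalCode_of_children (.and Γ A B env k q hΓ hA hB)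
      (.and Γ (closure A env) (closure B env) ha.crec hb.crec
        (ha.endS.trans (insert_eq_union_singleton _ _))
        (hb.endS.trans (insert_eq_union_singleton _ _))) ?_ ?_ fun i => ?_⟩
    · have hhead : CodedState.head (coded ⟨Γ, false, (.and A B, env, k) :: q⟩) =
        ((Fml.and A B).enc, env, k) := rfl
      have htag : (Fml.and A B).enc % 6 = 2 := hmod _ _ (by norm_num)
      have hcl : (coded ⟨Γ, false, (.and A B, env, k) :: q⟩).2.1 = false := rfl
      have hseq : (coded ⟨Γ, false, (.and A B, env, k) :: q⟩).1 = codeList Γ := rfl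
      have hav' : v (coded (child ⟨Γ, false, (.and A B, env, k) :: q⟩ 0)) = Part.some a :=
        Part.eq_some_iff.2 hav
      have hbv' : v (coded (child ⟨Γ, false, (.and A B, env, k) :: q⟩ 1)) = Part.some b :=
        Part.eq_some_iff.2 hbv
      rw [hv]
      simp only [hcl, hhead, htag, CodedState.labelList, hseq, hET.code _ hAB env,
        ← coded_child hET hN, ← encS_eq_encode_codeList]
      simp [hav', hbv', andC]
    · simp [nodeVal, proj_tup, label, axC, andC]
    · simp [EndS, proj_tup, label]
    · rcases i with _ | _ | i
      · exact .inl (by simpa [childCode, proj_tup, andC, omC, child] using ha)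
      · exact .inl (by simpa [childCode, proj_tup, andC, omC, child] using hb)
      · exact .inr ⟨by simp [childCode, proj_tup, andC, omC], rfl⟩
  | or Γ A B env k q hΓ h ih =>
    have hAB : (Fml.or A B).enc ≤ N := hN _ List.mem_cons_self
    obtain ⟨a, hav, ha⟩ := ih ((hN.tail.add (Bounded.or hAB).1 env).add (Bounded.or hAB).2 env)
    refine ⟨tup [orC, encS Γ, encF (closure (.or A B) env), a], ?_,
      isLocalCode_of_children (.or Γ A B env k q hΓ h)
      (.or Γ (closure A env) (closure B env) ha.crec
        (ha.endS.trans (insert_insert_eq_union_pair _ _ _))) ?_ ?_ fun i => ?_⟩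
    · have hhead : CodedState.head (coded ⟨Γ, false, (.or A B, env, k) :: q⟩) =
        ((Fml.or A B).enc, env, k) := rfl
      have htag : (Fml.or A B).enc % 6 = 3 := hmod _ _ (by norm_num)
      have hcl : (coded ⟨Γ, false, (.or A B, env, k) :: q⟩).2.1 = false := rfl
      have hseq : (coded ⟨Γ, false, (.or A B, env, k) :: q⟩).1 = codeList Γ := rfl
      have hav' : v (coded (child ⟨Γ, false, (.or A B, env, k) :: q⟩ 0)) = Part.some a :=
        Part.eq_some_iff.2 hav
      rw [hv]
      simp only [hcl, hhead, htag, CodedState.labelList, hseq, hET.code _ hAB env,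
        ← coded_child hET hN, ← encS_eq_encode_codeList]
      simp [hav', orC]
    · simp [nodeVal, proj_tup, label, axC, andC, orC]
    · simp [EndS, proj_tup, label]
    · rcases i with _ | i
      · exact .inl (by simpa [childCode, proj_tup, andC, orC, omC, child] using ha)
      · exact .inr ⟨by simp [childCode, proj_tup, andC, orC, omC], rfl⟩
  | all Γ A env k q hΓ h ih =>
    have hA : (Fml.all A).enc ≤ N := hN _ List.mem_cons_self
    choose a hav ha using fun n => ih n (hN.tail.add (Bounded.all hA) (n :: env))
    have he (n : ℕ) : peval (idx (coded ⟨Γ, false, (.all A, env, k) :: q⟩)) n =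
        Part.some (a n) := by
      rw [hidx, ← coded_child hET hN]
      exact Part.eq_some_iff.2 (hav n)
    refine ⟨tup [omC, encS Γ, encF (closure (.all A) env),
        idx (coded ⟨Γ, false, (.all A, env, k) :: q⟩)], ?_,
      isLocalCode_of_children (.all Γ A env k q hΓ h)
      (.om Γ (A.close env 1) (A.cu_close env 1) (by simp) (fun n => by simp [he])
        (fun n => by simpa [he, CrecM] using (ha n).crec) fun n => ?_) ?_ ?_ fun i => ?_⟩
    · have hhead : CodedState.head (coded ⟨Γ, false, (.all A, env, k) :: q⟩) =
        ((Fml.all A).enc, env, k) := rfl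
      have htag : (Fml.all A).enc % 6 = 4 := hmod _ _ (by norm_num)
      have hcl : (coded ⟨Γ, false, (.all A, env, k) :: q⟩).2.1 = false := rfl
      have hseq : (coded ⟨Γ, false, (.all A, env, k) :: q⟩).1 = codeList Γ := rfl
      rw [hv]
      simp only [hcl, hhead, htag, CodedState.labelList, hseq, hET.code _ hA env,
        ← coded_child hET hN, ← encS_eq_encode_codeList]
      simp [omC]
    · simp only [he, Part.get_some, sInst_close]
      exact (ha n).endS.trans (insert_eq_union_singleton _ _)
    · simp [nodeVal, proj_tup, label, axC, andC, orC, omC]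
    · simp [EndS, proj_tup, label]
    · exact .inl (by simpa [childCode, proj_tup, he, child] using ha i)
  | ex Γ A env k q hΓ h ih =>
    have hA : (Fml.ex A).enc ≤ N := hN _ List.mem_cons_self
    obtain ⟨a, hav, ha⟩ := ih ((hN.requeue _).add (Bounded.ex hA) (k :: env))
    refine ⟨tup [exC, encS Γ, encF (closure (.ex A) env), a], ?_,
      isLocalCode_of_children (.ex Γ A env k q hΓ h)
      (.ex Γ (A.close env 1) (A.cu_close env 1) k ha.crec ?_) ?_ ?_ fun i => ?_⟩
    · have hhead : CodedState.head (coded ⟨Γ, false, (.ex A, env, k) :: q⟩) =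
        ((Fml.ex A).enc, env, k) := rfl
      have htag : (Fml.ex A).enc % 6 = 5 := hmod _ _ (by norm_num)
      have hcl : (coded ⟨Γ, false, (.ex A, env, k) :: q⟩).2.1 = false := rfl
      have hseq : (coded ⟨Γ, false, (.ex A, env, k) :: q⟩).1 = codeList Γ := rfl
      have hav' : v (coded (child ⟨Γ, false, (.ex A, env, k) :: q⟩ 0)) = Part.some a :=
        Part.eq_some_iff.2 hav
      rw [hv]
      simp only [hcl, hhead, htag, CodedState.labelList, hseq, hET.code _ hA env,
        ← coded_child hET hN, ← encS_eq_encode_codeList]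
      simp [hav', exC]
    · rw [sInst_close]
      exact ha.endS.trans (insert_eq_union_singleton _ _)
    · simp [nodeVal, proj_tup, label, axC, andC, orC, omC, exC]
    · simp [EndS, proj_tup, label]
    · rcases i with _ | i
      · exact .inl (by simpa [childCode, proj_tup, andC, orC, omC, exC, child] using ha)
      · exact .inr ⟨by simp [childCode, proj_tup, andC, orC, omC, exC], rfl⟩

end SearchState

/-- **Shoenfield's completeness theorem (Tait version).**  Every sentence true
in `ℕ` has a recursive local code `a ∈ C_rec^-` whose decoded `ω`-proof `π(a)`
is a primitive recursive cut free `ω`-proof with end sequent `{A}`. -/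
theorem shoenfield_completeness (A : Sentence) (hA : sentTrue A) :
    ∃ a : ℕ, CrecM a ∧ EndS a = {A} ∧
      Nat.Primrec (piOf a) ∧ IsOmegaProof (piOf a) ∧ CutFree (piOf a) ∧
      EndS (piOf a rootSeq) = {A} := by
  obtain ⟨E, hE, hE'⟩ := exists_primrec₂_of_bounded_enc
    (fun B env => encF (closure B env)) primrec_encF_closure A.1.enc
  obtain ⟨T, hT, hT'⟩ := exists_primrec₂_of_bounded_enc trueLit primrec_trueLit A.1.enc
  have hET : SearchState.Computes A.1.enc E T := ⟨hE', hT'⟩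
  have hgood := SearchState.good_init hA
  have hbd : SearchState.Bounded A.1.enc (.init A) := (SearchState.bounded_dead _).add le_rfl []
  obtain ⟨a, ha⟩ := SearchState.exists_isLocalCode hE hT hET hgood hbd
  have hπ (σ : ℕ) : piOf a σ = if σ = 0 then 0
      else SearchState.label (.run (.init A) (untup σ)) := by
    rw [piOf, ha.node]
  refine ⟨a, ha.crec, ha.endS.trans (SearchState.sequent_init A),
    SearchState.primrec_of_eq_label_run hE hT hET hbd hπ,
    hgood.isOmegaProof hπ, hgood.cutFree hπ, ?_⟩
  rw [hπ, rootSeq, if_neg (tup_ne_zero _), untup_tup]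
  exact hgood.endS_label.trans (SearchState.sequent_init A)

end Shoen
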